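/- Let n ≥ 2, set d = n(2n−1), let a_j = n−j for 1 ≤ j ≤ n, let ρ = (n−1, n−2, …, 1, 0) ∈ ℝⁿ, and define the multiplicity polynomial m(x) = ∏_{1≤i<l≤n} (x_i² − x_l²)² / ∏_{1≤j<l≤n} (a_j² − a_l²)² for x ∈ ℝⁿ. Define, for λ > 0, 𝓝(λ) = (1/(2^{n−1} n!)) Σ_{b∈ℤⁿ} m(b+ρ) · 1_{|b+ρ|² ≤ λ + |ρ|²}. Then as λ → ∞, 𝓝(λ) = C λ^{d/2} + O(λ^{α}), where C = (1/(2^{n−1} n!)) ∫_{|x|≤1} m(x) dx and α = (2n³ + n² − 3n)/(2(n+1)). In particular, since α < (d−1)/2, the Avakumovic–Hörmander remainder exponent (d−1)/2 in Weyl's law is not sharp for this counting function (which is the spectral counting function of the Laplace–Beltrami operator on SO(2n) with its bi-invariant metric). -/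

import Mathlib

open MeasureTheory Filter Asymptotics Finset

noncomputable section

namespace WeylLaw

/-- The character `x ↦ exp (-2πi ξ·x)` of `ℝⁿ`. -/
def planeWave {n : ℕ} (ξ x : Fin n → ℝ) : ℂ :=
  Complex.exp (((-2 * Real.pi * ∑ i, ξ i * x i : ℝ) : ℂ) * Complex.I)

lemma planeWave_zero {n : ℕ} (x : Fin n → ℝ) : planeWave 0 x = 1 := by
  simp [planeWave]

@[fun_prop]
lemma continuous_planeWave {n : ℕ} (ξ : Fin n → ℝ) : Continuous (planeWave ξ) := by
  unfold planeWave
  fun_prop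

/-- The cast `ℤⁿ → ℝⁿ`. -/
def latticePoint {n : ℕ} (b : Fin n → ℤ) : Fin n → ℝ := fun i => (b i : ℝ)

lemma planeWave_add_latticePoint {n : ℕ} (ξ b : Fin n → ℤ) (x : Fin n → ℝ) :
    planeWave (latticePoint ξ) (x + latticePoint b) = planeWave (latticePoint ξ) x := by
  unfold planeWave latticePoint
  rw [Complex.exp_eq_exp_iff_exists_int]
  refine ⟨-∑ i, ξ i * b i, ?_⟩
  simp only [Pi.add_apply]
  push_cast
  simp only [mul_add, Finset.sum_add_distrib]
  ring

lemma mFourier_neg_coe {n : ℕ} (ξ : Fin n → ℤ) (x : Fin n → ℝ) :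
    UnitAddTorus.mFourier (-ξ) (fun i => (x i : UnitAddCircle))
      = planeWave (latticePoint ξ) x := by
  unfold UnitAddTorus.mFourier planeWave latticePoint
  simp only [ContinuousMap.coe_mk, fourier_coe_apply, Pi.neg_apply]
  rw [← Complex.exp_sum]
  congr 1
  push_cast
  rw [Finset.mul_sum, Finset.sum_mul]
  refine Finset.sum_congr rfl fun i _ => ?_
  simp
  ring

/-- The integer points in a cube. -/
def latticeCube (n : ℕ) (L : ℝ) : Finset (Fin n → ℤ) :=
  Fintype.piFinset fun _ => Finset.Icc (-⌈L⌉) ⌈L⌉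

lemma mem_latticeCube {n : ℕ} {L : ℝ} {b : Fin n → ℤ} (h : ‖latticePoint b‖ ≤ L) :
    b ∈ latticeCube n L := by
  rw [latticeCube, Fintype.mem_piFinset]
  intro i
  have h1 : |(b i : ℝ)| ≤ L := (norm_le_pi_norm (latticePoint b) i).trans h
  rw [abs_le] at h1
  rw [Finset.mem_Icc]
  have h2 := Int.le_ceil L
  constructor
  · exact_mod_cast (show (-(⌈L⌉ : ℝ)) ≤ b i by linarith)
  · exact_mod_cast (show (b i : ℝ) ≤ ⌈L⌉ by linarith)

lemma eq_zero_of_notMem_latticeCube {n : ℕ} {f : (Fin n → ℝ) → ℂ} {R L : ℝ}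
    (hf : ∀ x, R < ‖x‖ → f x = 0) {x : Fin n → ℝ} (hx : ‖x‖ ≤ L) {b : Fin n → ℤ}
    (hb : b ∉ latticeCube n (R + L)) : f (x + latticePoint b) = 0 := by
  apply hf
  by_contra! h
  apply hb
  apply mem_latticeCube
  have := norm_sub_le (x + latticePoint b) x
  rw [add_sub_cancel_left] at this
  linarith

lemma continuous_periodization {n : ℕ} {f : (Fin n → ℝ) → ℂ} (hc : Continuous f) {R : ℝ}
    (hf : ∀ x, R < ‖x‖ → f x = 0) :
    Continuous fun x => ∑' b : Fin n → ℤ, f (x + latticePoint b) := by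
  rw [continuous_iff_continuousAt]
  intro x₀
  have h : (fun x => ∑ b ∈ latticeCube n (R + (‖x₀‖ + 1)), f (x + latticePoint b))
      =ᶠ[nhds x₀] fun x => ∑' b : Fin n → ℤ, f (x + latticePoint b) := by
    filter_upwards [Metric.ball_mem_nhds x₀ one_pos] with x hx
    refine (tsum_eq_sum fun b hb => eq_zero_of_notMem_latticeCube hf ?_ hb).symm
    rw [mem_ball_iff_norm] at hx
    have := norm_le_norm_add_norm_sub' x x₀
    linarith
  refine ContinuousAt.congr (Continuous.continuousAt ?_) h
  fun_prop

/-- The half-open unit cube translated by an integer vector. -/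
def unitCube {n : ℕ} (b : Fin n → ℤ) : Set (Fin n → ℝ) :=
  {x | ∀ i, x i ∈ Set.Ioc (b i : ℝ) (b i + 1)}

lemma measurableSet_unitCube {n : ℕ} (b : Fin n → ℤ) : MeasurableSet (unitCube b) :=
  MeasurableSet.univ_pi' fun _ => measurableSet_Ioc

lemma iUnion_unitCube (n : ℕ) : ⋃ b : Fin n → ℤ, unitCube b = Set.univ := by
  refine Set.eq_univ_of_forall fun x => Set.mem_iUnion.2 ⟨fun i => ⌈x i⌉ - 1, fun i => ?_⟩
  have h1 := Int.le_ceil (x i)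
  have h2 := Int.ceil_lt_add_one (x i)
  push_cast
  constructor <;> linarith

lemma pairwise_disjoint_unitCube (n : ℕ) :
    Pairwise (Function.onFun Disjoint (unitCube : (Fin n → ℤ) → _)) := by
  intro b c hbc
  refine Set.disjoint_left.2 fun x hb hc => hbc (funext fun i => ?_)
  obtain ⟨h1, h2⟩ := hb i
  obtain ⟨h3, h4⟩ := hc i
  have h5 : (b i : ℝ) < c i + 1 := by linarith
  have h6 : (c i : ℝ) < b i + 1 := by linarith
  norm_cast at h5 h6
  omega

lemma norm_le_one_of_mem_unitCube_zero {n : ℕ} {x : Fin n → ℝ}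
    (hx : x ∈ unitCube (0 : Fin n → ℤ)) : ‖x‖ ≤ 1 := by
  refine (pi_norm_le_iff_of_nonneg zero_le_one).2 fun i => ?_
  obtain ⟨h1, h2⟩ := hx i
  simp only [Pi.zero_apply, Int.cast_zero, zero_add] at h1 h2
  rw [Real.norm_eq_abs, abs_le]
  constructor <;> linarith

lemma setIntegral_unitCube {n : ℕ} (g : (Fin n → ℝ) → ℂ) (b : Fin n → ℤ) :
    ∫ x in unitCube b, g x = ∫ x in unitCube (0 : Fin n → ℤ), g (x + latticePoint b) := by
  have h := (measurePreserving_add_right volume (latticePoint b)).setIntegral_preimage_emb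
    (measurableEmbedding_addRight (latticePoint b)) g (unitCube b)
  rw [← h]
  congr 2
  ext x
  simp only [unitCube, latticePoint, Set.mem_preimage, Set.mem_ofPred_eq, Set.mem_Ioc,
    Pi.add_apply, Pi.zero_apply, Int.cast_zero]
  refine forall_congr' fun i => ?_
  constructor <;> rintro ⟨h1, h2⟩ <;> constructor <;> linarith

lemma integral_periodization {n : ℕ} {g : (Fin n → ℝ) → ℂ} {R : ℝ}
    (hg : ∀ x, R < ‖x‖ → g x = 0) (hi : Integrable g) :
    ∫ x in unitCube (0 : Fin n → ℤ), ∑' b : Fin n → ℤ, g (x + latticePoint b) = ∫ x, g x := by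
  have hR : ∀ x ∈ unitCube (0 : Fin n → ℤ), ∀ b ∉ latticeCube n (R + 1),
      g (x + latticePoint b) = 0 := fun x hx b hb =>
    eq_zero_of_notMem_latticeCube hg (norm_le_one_of_mem_unitCube_zero hx) hb
  calc ∫ x in unitCube (0 : Fin n → ℤ), ∑' b : Fin n → ℤ, g (x + latticePoint b)
      = ∫ x in unitCube (0 : Fin n → ℤ), ∑ b ∈ latticeCube n (R + 1), g (x + latticePoint b) :=
        setIntegral_congr_fun (measurableSet_unitCube _) fun x hx => tsum_eq_sum (hR x hx)
    _ = ∑ b ∈ latticeCube n (R + 1), ∫ x in unitCube (0 : Fin n → ℤ), g (x + latticePoint b) :=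
        integral_finsetSum _ fun b _ => (hi.comp_add_right _).integrableOn
    _ = ∑ b ∈ latticeCube n (R + 1), ∫ x in unitCube b, g x := by
        simp only [setIntegral_unitCube g]
    _ = ∑' b, ∫ x in unitCube b, g x := by
        refine (tsum_eq_sum fun b hb => ?_).symm
        rw [setIntegral_unitCube]
        exact setIntegral_eq_zero_of_forall_eq_zero fun x hx => hR x hx b hb
    _ = ∫ x in ⋃ b, unitCube b, g x :=
        (integral_iUnion measurableSet_unitCube (pairwise_disjoint_unitCube n)
          hi.integrableOn).symm
    _ = ∫ x, g x := by rw [iUnion_unitCube, setIntegral_univ]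

/-- **Poisson summation** on `ℝⁿ` for continuous, compactly supported functions. -/
theorem hasSum_fourier_latticePoint {n : ℕ} {f : (Fin n → ℝ) → ℂ} (hc : Continuous f) {R : ℝ}
    (hf : ∀ x, R < ‖x‖ → f x = 0)
    (hs : Summable fun ξ : Fin n → ℤ => ∫ x, planeWave (latticePoint ξ) x * f x) :
    HasSum (fun ξ : Fin n → ℤ => ∫ x, planeWave (latticePoint ξ) x * f x)
      (∑' b : Fin n → ℤ, f (latticePoint b)) := by
  set P : (Fin n → ℝ) → ℂ := fun x => ∑' b : Fin n → ℤ, f (x + latticePoint b) with hP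
  have hq : IsOpenQuotientMap
      (Pi.map fun (_ : Fin n) (t : ℝ) => (t : UnitAddCircle)) :=
    IsOpenQuotientMap.piMap fun _ => QuotientAddGroup.isOpenQuotientMap_mk
  have hper : ∀ (x : Fin n → ℝ) (c : Fin n → ℤ), P (x + latticePoint c) = P x := by
    intro x c
    simp only [hP]
    rw [← (Equiv.addLeft c).tsum_eq (fun b => f (x + latticePoint b))]
    refine tsum_congr fun b => ?_
    congr 1
    ext i
    simp [latticePoint, add_assoc]
  have hfac : Function.FactorsThrough P
      (Pi.map fun (_ : Fin n) (t : ℝ) => (t : UnitAddCircle)) := by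
    intro x y hxy
    have h : ∀ i, ∃ c : ℤ, y i = x i + c := by
      intro i
      have h1 : (x i : UnitAddCircle) = (y i : UnitAddCircle) := congrFun hxy i
      have h2 : ((y i - x i : ℝ) : UnitAddCircle) = 0 := by
        rw [AddCircle.coe_sub, h1, sub_self]
      obtain ⟨c, hc⟩ := (AddCircle.coe_eq_zero_iff 1).1 h2
      refine ⟨c, ?_⟩
      rw [zsmul_one] at hc
      linarith
    choose c hc using h
    rw [← hper x c]
    congr 1
    ext i
    simp [latticePoint, hc]
  set π : (Fin n → ℝ) → UnitAddTorus (Fin n) :=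
    Pi.map fun (_ : Fin n) (t : ℝ) => (t : UnitAddCircle) with hπ
  have hG : ∀ x, Function.extend π P 0 (π x) = P x := fun x => hfac.extend_apply 0 x
  let G : C(UnitAddTorus (Fin n), ℂ) := ⟨Function.extend π P 0, by
    rw [← hq.continuous_comp_iff]
    exact (continuous_periodization hc hf).congr fun x => (hG x).symm⟩
  have hcoeff : ∀ ξ : Fin n → ℤ, UnitAddTorus.mFourierCoeff G ξ
      = ∫ x, planeWave (latticePoint ξ) x * f x := by
    intro ξ
    rw [UnitAddTorus.mFourierCoeff_eq_integral G ξ 0]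
    have hcg : Continuous fun x => planeWave (latticePoint ξ) x * f x := by fun_prop
    have hg : ∀ x, R < ‖x‖ → planeWave (latticePoint ξ) x * f x = 0 := fun x hx => by
      rw [hf x hx, mul_zero]
    have hi : Integrable fun x => planeWave (latticePoint ξ) x * f x :=
      hcg.integrable_of_hasCompactSupport <|
        HasCompactSupport.of_support_subset_isCompact (isCompact_closedBall 0 R) fun x hx => by
          rw [mem_closedBall_zero_iff]
          by_contra! h
          exact hx (hg x h)
    rw [← integral_periodization hg hi]
    have hset : {x : Fin n → ℝ | ∀ i, x i ∈ Set.Ioc ((0 : Fin n → ℝ) i) ((0 : Fin n → ℝ) i + 1)}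
        = unitCube (0 : Fin n → ℤ) := by
      simp [unitCube]
    rw [hset]
    refine setIntegral_congr_fun (measurableSet_unitCube _) fun x _ => ?_
    simp only [smul_eq_mul, planeWave_add_latticePoint]
    rw [mFourier_neg_coe, tsum_mul_left]
    congr 1
    exact hG x
  have h := UnitAddTorus.hasSum_mFourier_series_apply_of_summable
    (f := G) (hs.congr fun ξ => (hcoeff ξ).symm) (π 0)
  simp only [hcoeff] at h
  have h0 : G (π 0) = ∑' b : Fin n → ℤ, f (latticePoint b) := by
    change Function.extend π P 0 (π 0) = _
    rw [hG]
    simp [hP]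
  rw [h0] at h
  have h1 : ∀ ξ : Fin n → ℤ, UnitAddTorus.mFourier ξ (π 0) = 1 := fun ξ => by
    simp [UnitAddTorus.mFourier, hπ]
  simpa only [h1, smul_eq_mul, mul_one] using h

/-- The phase `exp (-iσ sin θ)`. -/
def sinPhase (σ θ : ℝ) : ℂ := Complex.exp (((-σ * Real.sin θ : ℝ) : ℂ) * Complex.I)

lemma norm_sinPhase (σ θ : ℝ) : ‖sinPhase σ θ‖ = 1 := Complex.norm_exp_ofReal_mul_I _

@[fun_prop]
lemma continuous_sinPhase (σ : ℝ) : Continuous (sinPhase σ) := by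
  unfold sinPhase
  fun_prop

lemma hasDerivAt_sinPhase (σ θ : ℝ) :
    HasDerivAt (sinPhase σ) (-(σ * Complex.I) * (Real.cos θ * sinPhase σ θ)) θ := by
  have h := ((((Real.hasDerivAt_sin θ).const_mul (-σ)).ofReal_comp).mul_const Complex.I).cexp
  refine h.congr_deriv ?_
  simp only [sinPhase]
  push_cast
  ring

lemma integral_mul_cos_mul_sinPhase {a b : ℝ} {g g' : ℝ → ℝ} (σ : ℝ)
    (hg : ∀ θ ∈ Set.uIcc a b, HasDerivAt g (g' θ) θ) (hg' : ContinuousOn g' (Set.uIcc a b)) :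
    (σ * Complex.I) * ∫ θ in a..b, ((g θ * Real.cos θ : ℝ) : ℂ) * sinPhase σ θ
      = g a * sinPhase σ a - g b * sinPhase σ b + ∫ θ in a..b, (g' θ : ℂ) * sinPhase σ θ := by
  have hgc : ContinuousOn g (Set.uIcc a b) := fun θ hθ => (hg θ hθ).continuousAt.continuousWithinAt
  have h1 : IntervalIntegrable (fun θ => (g' θ : ℂ) * sinPhase σ θ) volume a b :=
    ContinuousOn.intervalIntegrable (by fun_prop)
  have h2 : IntervalIntegrable (fun θ => ((g θ * Real.cos θ : ℝ) : ℂ) * sinPhase σ θ)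
      volume a b :=
    ContinuousOn.intervalIntegrable (by fun_prop)
  have h := intervalIntegral.integral_eq_sub_of_hasDerivAt
    (f := fun θ => (g θ : ℂ) * sinPhase σ θ)
    (f' := fun θ => (g' θ : ℂ) * sinPhase σ θ
      - (σ * Complex.I) * (((g θ * Real.cos θ : ℝ) : ℂ) * sinPhase σ θ))
    (fun θ hθ => by
      refine ((hg θ hθ).ofReal_comp.mul (hasDerivAt_sinPhase σ θ)).congr_deriv ?_
      push_cast
      ring) (h1.sub (h2.const_mul _))
  rw [intervalIntegral.integral_sub h1 (h2.const_mul _), intervalIntegral.integral_const_mul] at h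
  linear_combination -h

lemma norm_integral_mul_cos_mul_sinPhase_le {a b : ℝ} (hab : a ≤ b) {g g' B : ℝ → ℝ} {σ : ℝ}
    (hσ : 0 < σ) (hg : ∀ θ ∈ Set.uIcc a b, HasDerivAt g (g' θ) θ)
    (hg' : ContinuousOn g' (Set.uIcc a b)) (hB : ∀ θ ∈ Set.Icc a b, |g' θ| ≤ B θ)
    (hBi : IntervalIntegrable B volume a b) :
    σ * ‖∫ θ in a..b, ((g θ * Real.cos θ : ℝ) : ℂ) * sinPhase σ θ‖
      ≤ |g a| + |g b| + ∫ θ in a..b, B θ := by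
  have h := congrArg norm (integral_mul_cos_mul_sinPhase σ hg hg')
  rw [norm_mul, norm_mul, Complex.norm_I, mul_one, Complex.norm_real, Real.norm_of_nonneg hσ.le]
    at h
  rw [h]
  refine (norm_add_le _ _).trans (add_le_add ((norm_sub_le _ _).trans ?_) ?_)
  · simp [norm_sinPhase]
  · refine intervalIntegral.norm_integral_le_of_norm_le hab ?_ hBi
    refine Filter.Eventually.of_forall fun θ hθ => ?_
    simpa [norm_sinPhase] using hB θ (Set.Ioc_subset_Icc_self hθ)

/-- The oscillatory integral `∫ cos^M θ sin^l θ exp (-iσ sin θ) dθ` over `[-π/2, π/2]`. -/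
def oscInt (M l : ℕ) (σ : ℝ) : ℂ :=
  ∫ θ in (-(Real.pi / 2))..(Real.pi / 2),
    ((Real.cos θ ^ M * Real.sin θ ^ l : ℝ) : ℂ) * sinPhase σ θ

lemma abs_cos_pow_mul_sin_pow_le_one (M l : ℕ) (θ : ℝ) :
    |Real.cos θ ^ M * Real.sin θ ^ l| ≤ 1 := by
  rw [abs_mul, abs_pow, abs_pow]
  exact mul_le_one₀ (pow_le_one₀ (abs_nonneg _) (Real.abs_cos_le_one θ)) (by positivity)
    (pow_le_one₀ (abs_nonneg _) (Real.abs_sin_le_one θ))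

lemma oscInt_recursion (M l : ℕ) (σ : ℝ) :
    (σ * Complex.I) * oscInt (M + 2) l σ
      = l * oscInt (M + 2) (l - 1) σ - (M + 1) * oscInt M (l + 1) σ := by
  have h := integral_mul_cos_mul_sinPhase (a := -(Real.pi / 2)) (b := Real.pi / 2)
    (g := fun θ => Real.cos θ ^ (M + 1) * Real.sin θ ^ l)
    (g' := fun θ => l * (Real.cos θ ^ (M + 2) * Real.sin θ ^ (l - 1))
      - (M + 1) * (Real.cos θ ^ M * Real.sin θ ^ (l + 1))) σ
    (fun θ _ => by
      refine (((Real.hasDerivAt_cos θ).pow (M + 1)).mul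
        ((Real.hasDerivAt_sin θ).pow l)).congr_deriv ?_
      push_cast
      simp only [Pi.pow_apply]
      ring) (by fun_prop)
  simp only [Real.cos_neg, Real.cos_pi_div_two, ne_eq, Nat.add_eq_zero_iff, one_ne_zero, and_false,
    not_false_eq_true, zero_pow, zero_mul, Complex.ofReal_zero, sub_zero, zero_add] at h
  have e1 : ∀ θ : ℝ, Real.cos θ ^ (M + 1) * Real.sin θ ^ l * Real.cos θ
      = Real.cos θ ^ (M + 2) * Real.sin θ ^ l := fun θ => by ring
  simp only [e1] at h
  rw [oscInt, h, oscInt, oscInt, ← intervalIntegral.integral_const_mul,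
    ← intervalIntegral.integral_const_mul, ← intervalIntegral.integral_sub]
  · refine intervalIntegral.integral_congr fun θ _ => ?_
    push_cast
    ring
  all_goals
    refine Continuous.intervalIntegrable ?_ _ _
    fun_prop

lemma norm_oscInt_zero_le (l : ℕ) {σ : ℝ} (hσ : 1 ≤ σ) :
    √σ * ‖oscInt 0 l σ‖ ≤ 2 + 2 * Real.pi + l * Real.pi := by
  have hσ0 : 0 < √σ := Real.sqrt_pos.2 (by linarith)
  have hσ1 : 1 ≤ √σ := Real.one_le_sqrt.2 hσ
  have hσσ : √σ * √σ = σ := Real.mul_self_sqrt (by linarith)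
  set δ := 1 / √σ with hδ
  have hδ0 : 0 < δ := by positivity
  have hδ1 : δ ≤ 1 := (div_le_one hσ0).2 hσ1
  have hδσ : √σ * δ = 1 := by
    rw [hδ]
    field_simp
  set c := Real.pi / 2 - δ with hc
  have hc0 : 0 < c := by linarith [Real.pi_gt_three]
  have hcos : ∀ θ ∈ Set.Icc (-c) c, 0 < Real.cos θ := fun θ hθ =>
    Real.cos_pos_of_mem_Ioo ⟨by linarith [hθ.1], by linarith [hθ.2]⟩
  have hcc : 2 / Real.pi * δ ≤ Real.cos c := by
    rw [hc, Real.cos_pi_div_two_sub]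
    exact Real.mul_le_sin hδ0.le (by linarith [Real.pi_gt_three])
  have hcc0 : 0 < Real.cos c := hcos c ⟨by linarith, le_rfl⟩
  have hinv : 1 / Real.cos c ≤ Real.pi / 2 * √σ := by
    rw [div_le_iff₀ hcc0]
    calc (1 : ℝ) = Real.pi / 2 * √σ * (2 / Real.pi * δ) := by
          have := Real.pi_ne_zero
          field_simp
          linarith
      _ ≤ _ := mul_le_mul_of_nonneg_left hcc (by positivity)
  have huIcc : Set.uIcc (-c) c = Set.Icc (-c) c := Set.uIcc_of_le (by linarith)
  have hne : ∀ θ ∈ Set.uIcc (-c) c, Real.cos θ ≠ 0 := fun θ hθ =>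
    (hcos θ (huIcc ▸ hθ)).ne'
  have hBc : ContinuousOn (fun θ : ℝ => 1 / Real.cos θ ^ 2) (Set.uIcc (-c) c) :=
    ContinuousOn.div (by fun_prop) (by fun_prop) fun θ hθ => pow_ne_zero 2 (hne θ hθ)
  have hsinabs : ∀ (k : ℕ) (θ : ℝ), |Real.sin θ ^ k| ≤ 1 := fun k θ => by
    simpa using abs_cos_pow_mul_sin_pow_le_one 0 k θ
  have hmid := norm_integral_mul_cos_mul_sinPhase_le (a := -c) (b := c) (σ := σ)
    (g := fun θ => Real.sin θ ^ l / Real.cos θ)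
    (g' := fun θ => l * Real.sin θ ^ (l - 1) + Real.sin θ ^ (l + 1) * (1 / Real.cos θ ^ 2))
    (B := fun θ => l + 1 / Real.cos θ ^ 2) (by linarith) (by linarith)
    (fun θ hθ => by
      refine (((Real.hasDerivAt_sin θ).pow l).div (Real.hasDerivAt_cos θ)
        (hne θ hθ)).congr_deriv ?_
      have := hne θ hθ
      simp only [Pi.pow_apply]
      field_simp
      ring) (by fun_prop)
    (fun θ _ => by
      refine (abs_add_le _ _).trans (add_le_add ?_ ?_)
      · rw [abs_mul, Nat.abs_cast]
        exact mul_le_of_le_one_right (Nat.cast_nonneg l) (hsinabs _ _)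
      · rw [abs_mul, abs_of_nonneg (by positivity : 0 ≤ 1 / Real.cos θ ^ 2)]
        exact mul_le_of_le_one_left (by positivity) (hsinabs _ _))
    ((ContinuousOn.intervalIntegrable (by fun_prop)).add hBc.intervalIntegrable)
  have htan : ∫ θ in (-c)..c, 1 / Real.cos θ ^ 2 = 2 * (Real.sin c / Real.cos c) := by
    rw [intervalIntegral.integral_eq_sub_of_hasDerivAt
      (fun θ hθ => Real.hasDerivAt_tan (hne θ hθ)) hBc.intervalIntegrable, Real.tan_neg,
      Real.tan_eq_sin_div_cos]
    ring
  rw [intervalIntegral.integral_add (by simp) hBc.intervalIntegrable, htan,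
    intervalIntegral.integral_const, Real.cos_neg] at hmid
  have hq : ∀ x : ℝ, |x| ≤ 1 → |x / Real.cos c| ≤ Real.pi / 2 * √σ := fun x hx => by
    rw [abs_div, abs_of_pos hcc0]
    exact (div_le_div_of_nonneg_right hx hcc0.le).trans hinv
  have hmid' : σ * ‖∫ θ in (-c)..c, ((Real.sin θ ^ l : ℝ) : ℂ) * sinPhase σ θ‖
      ≤ 2 * Real.pi * √σ + l * Real.pi := by
    have e : ∫ θ in (-c)..c, ((Real.sin θ ^ l : ℝ) : ℂ) * sinPhase σ θ
        = ∫ θ in (-c)..c, ((Real.sin θ ^ l / Real.cos θ * Real.cos θ : ℝ) : ℂ)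
          * sinPhase σ θ :=
      intervalIntegral.integral_congr fun θ hθ => by
        simp only [div_mul_cancel₀ _ (hne θ hθ)]
    rw [e]
    refine hmid.trans ?_
    have h1 := hq _ (hsinabs l (-c))
    have h2 := hq _ (hsinabs l c)
    have h3 := (le_abs_self _).trans (hq _ (Real.abs_sin_le_one c))
    have h4 : (c - -c) • (l : ℝ) ≤ l * Real.pi := by
      rw [smul_eq_mul, mul_comm]
      exact mul_le_mul_of_nonneg_left (by linarith) (Nat.cast_nonneg l)
    linarith
  have hint : ∀ a b : ℝ, IntervalIntegrable
      (fun θ => ((Real.sin θ ^ l : ℝ) : ℂ) * sinPhase σ θ) volume a b := fun a b =>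
    Continuous.intervalIntegrable (by fun_prop) _ _
  have hend : ∀ a b : ℝ, b - a = δ →
      ‖∫ θ in a..b, ((Real.sin θ ^ l : ℝ) : ℂ) * sinPhase σ θ‖ ≤ δ := by
    intro a b hab
    have h := intervalIntegral.norm_integral_le_of_norm_le_const (a := a) (b := b) (C := 1)
      (f := fun θ => ((Real.sin θ ^ l : ℝ) : ℂ) * sinPhase σ θ) fun θ _ => by
        rw [norm_mul, norm_sinPhase, mul_one, Complex.norm_real, Real.norm_eq_abs]
        exact hsinabs l θ
    rwa [hab, one_mul, abs_of_pos hδ0] at h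
  have hsplit : oscInt 0 l σ
      = (∫ θ in (-(Real.pi / 2))..(-c), ((Real.sin θ ^ l : ℝ) : ℂ) * sinPhase σ θ)
        + (∫ θ in (-c)..c, ((Real.sin θ ^ l : ℝ) : ℂ) * sinPhase σ θ)
        + ∫ θ in c..(Real.pi / 2), ((Real.sin θ ^ l : ℝ) : ℂ) * sinPhase σ θ := by
    rw [intervalIntegral.integral_add_adjacent_intervals (hint _ _) (hint _ _),
      intervalIntegral.integral_add_adjacent_intervals (hint _ _) (hint _ _)]
    simp only [oscInt, pow_zero, one_mul]
  have h1 := hend (-(Real.pi / 2)) (-c) (by rw [hc]; ring)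
  have h2 := hend c (Real.pi / 2) (by rw [hc]; ring)
  have hmid'' : √σ * ‖∫ θ in (-c)..c, ((Real.sin θ ^ l : ℝ) : ℂ) * sinPhase σ θ‖
      ≤ 2 * Real.pi + l * Real.pi := by
    refine le_of_mul_le_mul_left ?_ hσ0
    rw [← mul_assoc, hσσ]
    have : 0 ≤ l * Real.pi := by positivity
    nlinarith
  calc √σ * ‖oscInt 0 l σ‖
      ≤ √σ * (δ + ‖∫ θ in (-c)..c, ((Real.sin θ ^ l : ℝ) : ℂ) * sinPhase σ θ‖ + δ) := by
        rw [hsplit]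
        refine mul_le_mul_of_nonneg_left ?_ hσ0.le
        exact (norm_add₃_le).trans (by gcongr)
    _ = 2 * (√σ * δ)
          + √σ * ‖∫ θ in (-c)..c, ((Real.sin θ ^ l : ℝ) : ℂ) * sinPhase σ θ‖ := by ring
    _ ≤ _ := by
        rw [hδσ]
        linarith

lemma norm_oscInt_one_le (l : ℕ) {σ : ℝ} (hσ : 1 ≤ σ) :
    σ * ‖oscInt 1 l σ‖ ≤ 2 + l * Real.pi := by
  have h := norm_integral_mul_cos_mul_sinPhase_le (a := -(Real.pi / 2)) (b := Real.pi / 2)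
    (by linarith [Real.pi_pos]) (g := fun θ => Real.sin θ ^ l)
    (g' := fun θ => l * Real.sin θ ^ (l - 1) * Real.cos θ) (B := fun _ => l)
    (zero_lt_one.trans_le hσ) (fun θ _ => (Real.hasDerivAt_sin θ).pow l) (by fun_prop)
    (fun θ _ => by
      have := abs_cos_pow_mul_sin_pow_le_one 1 (l - 1) θ
      rw [show l * Real.sin θ ^ (l - 1) * Real.cos θ
        = l * (Real.cos θ ^ 1 * Real.sin θ ^ (l - 1)) by ring, abs_mul, Nat.abs_cast]
      exact mul_le_of_le_one_right (Nat.cast_nonneg l) this) (by simp)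
  have e : oscInt 1 l σ = ∫ θ in (-(Real.pi / 2))..(Real.pi / 2),
      ((Real.sin θ ^ l * Real.cos θ : ℝ) : ℂ) * sinPhase σ θ := by
    simp only [oscInt, pow_one, mul_comm (Real.cos _)]
  rw [e]
  refine h.trans ?_
  simp
  nlinarith

lemma exists_norm_oscInt_le (M : ℕ) :
    ∀ l, ∃ C, ∀ σ : ℝ, 1 ≤ σ → √σ ^ (M + 1) * ‖oscInt M l σ‖ ≤ C := by
  induction M using Nat.twoStepInduction with
  | zero => exact fun l => ⟨_, fun σ hσ => by simpa using norm_oscInt_zero_le l hσ⟩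
  | one =>
    refine fun l => ⟨2 + l * Real.pi, fun σ hσ => ?_⟩
    rw [one_add_one_eq_two, Real.sq_sqrt (by linarith)]
    exact norm_oscInt_one_le l hσ
  | more M ih _ =>
    have key : ∀ l (σ : ℝ), 1 ≤ σ → √σ ^ (M + 3) * ‖oscInt (M + 2) l σ‖ ≤
        l * (√σ ^ (M + 1) * ‖oscInt (M + 2) (l - 1) σ‖)
          + (M + 1) * (√σ ^ (M + 1) * ‖oscInt M (l + 1) σ‖) := by
      intro l σ hσ
      have h := congrArg norm (oscInt_recursion M l σ)
      rw [norm_mul, norm_mul, Complex.norm_I, mul_one, Complex.norm_real,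
        Real.norm_of_nonneg (by linarith)] at h
      have h2 := norm_sub_le ((l : ℂ) * oscInt (M + 2) (l - 1) σ)
        ((M + 1) * oscInt M (l + 1) σ)
      have h3 : ‖(M + 1 : ℂ)‖ = M + 1 := by exact_mod_cast Complex.norm_natCast (M + 1)
      rw [← h, norm_mul, norm_mul, Complex.norm_natCast, h3] at h2
      have h4 : √σ ^ (M + 3) = √σ ^ (M + 1) * σ := by
        rw [show M + 3 = M + 1 + 2 by ring, pow_add _ (M + 1) 2, Real.sq_sqrt (by linarith)]
      rw [h4, mul_assoc]
      refine (mul_le_mul_of_nonneg_left h2 (by positivity)).trans (le_of_eq ?_)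
      ring
    intro l
    induction l with
    | zero =>
      obtain ⟨C, hC⟩ := ih 1
      refine ⟨(M + 1) * C, fun σ hσ => (key 0 σ hσ).trans ?_⟩
      simpa using mul_le_mul_of_nonneg_left (hC σ hσ) (by positivity : (0 : ℝ) ≤ M + 1)
    | succ l ihl =>
      obtain ⟨C, hC⟩ := ih (l + 2)
      obtain ⟨D, hD⟩ := ihl
      refine ⟨(l + 1) * D + (M + 1) * C, fun σ hσ => (key (l + 1) σ hσ).trans ?_⟩
      rw [Nat.cast_succ, Nat.add_sub_cancel]
      refine add_le_add (mul_le_mul_of_nonneg_left (le_trans ?_ (hD σ hσ)) (by positivity))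
        (mul_le_mul_of_nonneg_left (hC σ hσ) (by positivity))
      refine mul_le_mul_of_nonneg_right (pow_le_pow_right₀ ?_ (by omega)) (norm_nonneg _)
      exact Real.one_le_sqrt.2 hσ

/-- The normalised Riesz weight `t₊^N / N!`, with `t₊^0` the indicator function of `[0, ∞)`. -/
def rieszWeight (N : ℕ) (t : ℝ) : ℝ := if 0 ≤ t then t ^ N / N.factorial else 0

lemma rieszWeight_of_nonneg (N : ℕ) {t : ℝ} (ht : 0 ≤ t) :
    rieszWeight N t = t ^ N / N.factorial := if_pos ht

lemma rieszWeight_of_neg (N : ℕ) {t : ℝ} (ht : t < 0) : rieszWeight N t = 0 :=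
  if_neg (not_le.2 ht)

lemma rieszWeight_succ (N : ℕ) (t : ℝ) :
    rieszWeight (N + 1) t = max t 0 ^ (N + 1) / (N + 1).factorial := by
  rcases le_or_gt 0 t with ht | ht
  · rw [rieszWeight_of_nonneg _ ht, max_eq_left ht]
  · rw [rieszWeight_of_neg _ ht, max_eq_right ht.le]
    simp

lemma rieszWeight_mul {c : ℝ} (hc : 0 < c) (N : ℕ) (t : ℝ) :
    rieszWeight N (c * t) = c ^ N * rieszWeight N t := by
  rcases le_or_gt 0 t with ht | ht
  · rw [rieszWeight_of_nonneg _ ht, rieszWeight_of_nonneg _ (mul_nonneg hc.le ht), mul_pow]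
    ring
  · rw [rieszWeight_of_neg _ ht, rieszWeight_of_neg _ (mul_neg_of_pos_of_neg hc ht), mul_zero]

@[fun_prop]
lemma continuous_rieszWeight_succ (N : ℕ) : Continuous (rieszWeight (N + 1)) := by
  simp only [funext (rieszWeight_succ N)]
  fun_prop

@[fun_prop]
lemma measurable_rieszWeight (N : ℕ) : Measurable (rieszWeight N) :=
  Measurable.ite measurableSet_Ici (by fun_prop) measurable_const

lemma hasDerivAt_rieszWeight_succ (N : ℕ) {t : ℝ} (ht : t ≠ 0) :
    HasDerivAt (rieszWeight (N + 1)) (rieszWeight N t) t := by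
  rcases ht.lt_or_gt with ht | ht
  · rw [rieszWeight_of_neg _ ht]
    refine (hasDerivAt_const t (0 : ℝ)).congr_of_eventuallyEq ?_
    filter_upwards [Iio_mem_nhds ht] with s hs
    exact rieszWeight_of_neg _ hs
  · rw [rieszWeight_of_nonneg _ ht.le]
    have h : HasDerivAt (fun s : ℝ => s ^ (N + 1) / (N + 1).factorial)
        (t ^ N / N.factorial) t := by
      refine ((hasDerivAt_pow (N + 1) t).div_const _).congr_deriv ?_
      rw [Nat.factorial_succ]
      push_cast
      have := Nat.factorial_ne_zero N
      field_simp
    refine h.congr_of_eventuallyEq ?_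
    filter_upwards [Ioi_mem_nhds ht] with s hs
    exact rieszWeight_of_nonneg _ (le_of_lt hs)

lemma monotone_rieszWeight (N : ℕ) : Monotone (rieszWeight N) := by
  intro s t hst
  rcases le_or_gt 0 s with hs | hs
  · rw [rieszWeight_of_nonneg _ hs, rieszWeight_of_nonneg _ (hs.trans hst)]
    gcongr
  · rw [rieszWeight_of_neg _ hs, rieszWeight]
    split_ifs with ht
    · positivity
    · exact le_rfl

lemma integral_rieszWeight (N : ℕ) (a b : ℝ) :
    ∫ t in a..b, rieszWeight N t = rieszWeight (N + 1) b - rieszWeight (N + 1) a :=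
  integral_eq_of_hasDerivAt_off_countable _ _ (Set.countable_singleton 0)
    (by fun_prop) (fun _ ht => hasDerivAt_rieszWeight_succ N ht.2)
    (monotone_rieszWeight N).intervalIntegrable

/-- The squared Euclidean length. -/
def sqLen {n : ℕ} (x : Fin n → ℝ) : ℝ := ∑ i, x i ^ 2

@[fun_prop]
lemma continuous_sqLen {n : ℕ} : Continuous (sqLen (n := n)) := by
  unfold sqLen
  fun_prop

lemma sqLen_nonneg {n : ℕ} (x : Fin n → ℝ) : 0 ≤ sqLen x :=
  Finset.sum_nonneg fun _ _ => sq_nonneg _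

lemma sq_le_sqLen {n : ℕ} (x : Fin n → ℝ) (i : Fin n) : x i ^ 2 ≤ sqLen x :=
  Finset.single_le_sum (f := fun i => x i ^ 2) (fun _ _ => sq_nonneg _) (Finset.mem_univ i)

lemma norm_le_sqrt_sqLen {n : ℕ} (x : Fin n → ℝ) : ‖x‖ ≤ √(sqLen x) :=
  (pi_norm_le_iff_of_nonneg (Real.sqrt_nonneg _)).2 fun i =>
    Real.abs_le_sqrt (sq_le_sqLen x i)

lemma sqLen_smul {n : ℕ} (c : ℝ) (x : Fin n → ℝ) : sqLen (c • x) = c ^ 2 * sqLen x := by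
  simp only [sqLen, Pi.smul_apply, smul_eq_mul, mul_pow, Finset.mul_sum]

lemma sqLen_insertNth {k : ℕ} (j : Fin (k + 1)) (t : ℝ) (y : Fin k → ℝ) :
    sqLen (j.insertNth t y : Fin (k + 1) → ℝ) = t ^ 2 + sqLen y := by
  simp [sqLen, Fin.sum_univ_succAbove _ j]

lemma isCompact_sqLen_le {n : ℕ} (lam : ℝ) : IsCompact {x : Fin n → ℝ | sqLen x ≤ lam} := by
  refine Metric.isCompact_of_isClosed_isBounded
    (isClosed_le continuous_sqLen continuous_const) ?_
  refine (Metric.isBounded_closedBall (x := (0 : Fin n → ℝ)) (r := √lam)).subset fun x hx => ?_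
  rw [mem_closedBall_zero_iff]
  exact (norm_le_sqrt_sqLen x).trans (Real.sqrt_le_sqrt hx)

lemma integrable_rieszWeight_sub_smul {X E : Type*} [TopologicalSpace X] [MeasurableSpace X]
    [BorelSpace X] [T2Space X] [NormedAddCommGroup E] [NormedSpace ℝ E] {μ : Measure X}
    [IsFiniteMeasureOnCompacts μ] {q : X → ℝ} {lam : ℝ} (hq : Continuous q)
    (hK : IsCompact {x | q x ≤ lam}) {g : X → E} (hg : Continuous g) (N : ℕ) :
    Integrable (fun x => rieszWeight N (lam - q x) • g x) μ := by
  have h : (fun x => rieszWeight N (lam - q x) • g x)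
      = {x | q x ≤ lam}.indicator fun x => ((lam - q x) ^ N / N.factorial) • g x := by
    ext x
    simp only [Set.indicator, Set.mem_ofPred_eq, rieszWeight, sub_nonneg]
    split_ifs <;> simp
  rw [h, integrable_indicator_iff hK.measurableSet]
  exact ContinuousOn.integrableOn_compact' hK hK.measurableSet (by fun_prop)

lemma integrable_rieszWeight_smul {n : ℕ} {E : Type*} [NormedAddCommGroup E] [NormedSpace ℝ E]
    {g : (Fin n → ℝ) → E} (hg : Continuous g) (N : ℕ) (lam : ℝ) :
    Integrable fun x => rieszWeight N (lam - sqLen x) • g x :=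
  integrable_rieszWeight_sub_smul continuous_sqLen (isCompact_sqLen_le lam) hg N

lemma isCompact_sq_le (lam : ℝ) : IsCompact {t : ℝ | t ^ 2 ≤ lam} := by
  refine Metric.isCompact_of_isClosed_isBounded
    (isClosed_le (by fun_prop) continuous_const) ?_
  refine (Metric.isBounded_closedBall (x := (0 : ℝ)) (r := √lam)).subset fun t ht => ?_
  rw [mem_closedBall_zero_iff]
  exact Real.abs_le_sqrt ht

lemma integral_eq_integral_integral_insertNth {k : ℕ} {E : Type*} [NormedAddCommGroup E]
    [NormedSpace ℝ E] (j : Fin (k + 1)) {f : (Fin (k + 1) → ℝ) → E} (hf : Integrable f) :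
    ∫ x, f x = ∫ t : ℝ, ∫ y : Fin k → ℝ, f (j.insertNth t y) := by
  have h := (volume_preserving_piFinSuccAbove (fun _ : Fin (k + 1) => ℝ) j).symm
  rw [← h.integral_comp', Measure.volume_eq_prod, integral_prod]
  · rfl
  · exact (h.integrable_comp_emb (MeasurableEquiv.measurableEmbedding _)).2 hf

lemma integral_eq_integral_integral_insertNth' {k : ℕ} {E : Type*} [NormedAddCommGroup E]
    [NormedSpace ℝ E] (j : Fin (k + 1)) {f : (Fin (k + 1) → ℝ) → E} (hf : Integrable f) :
    ∫ x, f x = ∫ y : Fin k → ℝ, ∫ t : ℝ, f (j.insertNth t y) := by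
  have h := (volume_preserving_piFinSuccAbove (fun _ : Fin (k + 1) => ℝ) j).symm
  rw [← h.integral_comp', Measure.volume_eq_prod, integral_prod_symm]
  · rfl
  · exact (h.integrable_comp_emb (MeasurableEquiv.measurableEmbedding _)).2 hf

/-- The Fourier transform at `ξ` of the Riesz weight `(r² - |x|²)₊^N / N!` times `p`. -/
def rieszFourier {n : ℕ} (p : (Fin n → ℝ) → ℝ) (N : ℕ) (r : ℝ) (ξ : Fin n → ℝ) : ℂ :=
  ∫ x, rieszWeight N (r ^ 2 - sqLen x) • ((p x : ℂ) * planeWave ξ x)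

lemma integral_euclidean {n : ℕ} {E : Type*} [NormedAddCommGroup E] [NormedSpace ℝ E]
    (f : (Fin n → ℝ) → E) :
    ∫ x : EuclideanSpace ℝ (Fin n), f (WithLp.ofLp x) = ∫ x, f x :=
  (EuclideanSpace.volume_preserving_symm_measurableEquiv_toLp (Fin n)).integral_comp' f

lemma sqLen_ofLp {n : ℕ} (x : EuclideanSpace ℝ (Fin n)) :
    sqLen (WithLp.ofLp x) = ‖x‖ ^ 2 := by
  rw [EuclideanSpace.real_norm_sq_eq]
  rfl

lemma planeWave_ofLp {n : ℕ} (ξ x : EuclideanSpace ℝ (Fin n)) :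
    planeWave (WithLp.ofLp ξ) (WithLp.ofLp x)
      = Complex.exp (((-2 * Real.pi * inner ℝ ξ x : ℝ) : ℂ) * Complex.I) := by
  have h : ∑ i, ξ i * x i = inner ℝ ξ x := by
    rw [PiLp.inner_apply]
    exact Finset.sum_congr rfl fun i _ => by simp [mul_comm]
  rw [planeWave, h]

lemma rieszFourier_one_eq_of_sqLen_eq {n : ℕ} (N : ℕ) (r : ℝ) {ξ η : Fin n → ℝ}
    (h : sqLen ξ = sqLen η) :
    rieszFourier (fun _ => 1) N r ξ = rieszFourier (fun _ => 1) N r η := by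
  have key : ∀ ζ : EuclideanSpace ℝ (Fin n), rieszFourier (fun _ => 1) N r (WithLp.ofLp ζ)
      = ∫ x : EuclideanSpace ℝ (Fin n), rieszWeight N (r ^ 2 - ‖x‖ ^ 2) •
        Complex.exp (((-2 * Real.pi * inner ℝ ζ x : ℝ) : ℂ) * Complex.I) := by
    intro ζ
    rw [rieszFourier, ← integral_euclidean]
    refine integral_congr_ae (.of_forall fun x => ?_)
    simp only [sqLen_ofLp, planeWave_ofLp, Complex.ofReal_one, one_mul]
  set v := WithLp.toLp 2 ξ with hv
  set w := WithLp.toLp 2 η with hw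
  have hvw : ‖v‖ = ‖w‖ := by
    rw [← sq_eq_sq₀ (norm_nonneg _) (norm_nonneg _), ← sqLen_ofLp, ← sqLen_ofLp]
    exact h
  let e : EuclideanSpace ℝ (Fin n) ≃ₗᵢ[ℝ] EuclideanSpace ℝ (Fin n) :=
    Submodule.reflection (ℝ ∙ (v - w))ᗮ
  have he : e v = w := Submodule.reflection_sub hvw
  refine (key v).trans (Eq.trans ?_ (key w).symm)
  refine Eq.trans ?_ (e.measurePreserving.integral_comp' (f := e.toMeasurableEquiv) _)
  refine integral_congr_ae (.of_forall fun x => ?_)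
  have h3 : inner ℝ w (e x) = inner ℝ v x := by rw [← he, e.inner_map_map]
  change _ = rieszWeight N (r ^ 2 - ‖e x‖ ^ 2) • Complex.exp
    (((-2 * Real.pi * inner ℝ w (e x) : ℝ) : ℂ) * Complex.I)
  rw [h3, e.norm_map]

/-- The volume `∫ (1 - |y|²)₊^N / N! dy`. -/
def rieszVolume (k N : ℕ) : ℝ := ∫ y : Fin k → ℝ, rieszWeight N (1 - sqLen y)

lemma rieszVolume_nonneg (k N : ℕ) : 0 ≤ rieszVolume k N :=
  integral_nonneg fun y => by
    unfold rieszWeight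
    simp only [Pi.zero_apply]
    split_ifs <;> positivity

lemma integral_rieszWeight_sub_sqLen (k N : ℕ) {c : ℝ} (hc : 0 < c) :
    ∫ y : Fin k → ℝ, rieszWeight N (c ^ 2 - sqLen y) = c ^ (2 * N + k) * rieszVolume k N := by
  have h := Measure.integral_comp_smul volume
    (fun y : Fin k → ℝ => rieszWeight N (c ^ 2 - sqLen y)) c
  have e : ∀ y : Fin k → ℝ, rieszWeight N (c ^ 2 - sqLen (c • y))
      = (c ^ 2) ^ N * rieszWeight N (1 - sqLen y) := fun y => by
    rw [sqLen_smul, ← rieszWeight_mul (by positivity)]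
    congr 1
    ring
  simp only [e, integral_const_mul, Module.finrank_fintype_fun_eq_card, Fintype.card_fin,
    smul_eq_mul] at h
  rw [abs_of_pos (by positivity), ← div_eq_inv_mul, eq_div_iff (by positivity)] at h
  rw [← h, rieszVolume]
  ring

lemma sqLen_single {k : ℕ} (s : ℝ) : sqLen (Fin.cons s 0 : Fin (k + 1) → ℝ) = s ^ 2 := by
  simp [sqLen, Fin.sum_univ_succ]

lemma rieszFourier_one_cons (k N : ℕ) {r : ℝ} (hr : 0 < r) (s : ℝ) :
    rieszFourier (fun _ => 1) N r (Fin.cons s 0 : Fin (k + 1) → ℝ)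
      = (rieszVolume k N * r ^ (2 * N + k + 1) : ℝ)
        * oscInt (2 * N + k + 1) 0 (2 * Real.pi * (s * r)) := by
  set G : ℝ → ℂ := fun t => ((rieszVolume k N * √(r ^ 2 - t ^ 2) ^ (2 * N + k) : ℝ) : ℂ)
    * Complex.exp (((-2 * Real.pi * (s * t) : ℝ) : ℂ) * Complex.I) with hG
  have hGc : Continuous G := by
    rw [hG]
    fun_prop
  have hint : Integrable fun x : Fin (k + 1) → ℝ => rieszWeight N (r ^ 2 - sqLen x) •
      (((1 : ℝ) : ℂ) * planeWave (Fin.cons s 0) x) :=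
    integrable_rieszWeight_smul (by fun_prop) _ _
  have hinner : ∀ t : ℝ, ∫ y : Fin k → ℝ, rieszWeight N
      (r ^ 2 - sqLen ((0 : Fin (k + 1)).insertNth t y : Fin (k + 1) → ℝ)) •
      (((1 : ℝ) : ℂ) * planeWave (Fin.cons s 0) ((0 : Fin (k + 1)).insertNth t y))
      = ((∫ y : Fin k → ℝ, rieszWeight N (r ^ 2 - t ^ 2 - sqLen y) : ℝ) : ℂ)
        * Complex.exp (((-2 * Real.pi * (s * t) : ℝ) : ℂ) * Complex.I) := by
    intro t
    rw [← integral_complex_ofReal, ← integral_mul_const]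
    refine integral_congr_ae (.of_forall fun y => ?_)
    dsimp only
    rw [sqLen_insertNth]
    simp only [planeWave, Fin.sum_univ_succ, Fin.insertNth_zero', Fin.cons_zero,
      Fin.cons_succ, Pi.zero_apply, zero_mul, Finset.sum_const_zero, add_zero,
      Complex.ofReal_one, one_mul, Complex.real_smul, sub_sub]
  rw [rieszFourier, integral_eq_integral_integral_insertNth 0 hint]
  simp only [hinner]
  have hrestrict : ∫ t : ℝ, ((∫ y : Fin k → ℝ, rieszWeight N (r ^ 2 - t ^ 2 - sqLen y) : ℝ) : ℂ)
        * Complex.exp (((-2 * Real.pi * (s * t) : ℝ) : ℂ) * Complex.I)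
      = ∫ t in (-r)..r, G t := by
    rw [intervalIntegral.integral_of_le (by linarith), integral_Ioc_eq_integral_Ioo,
      ← integral_indicator measurableSet_Ioo]
    have hne : ∀ᵐ t : ℝ, t ≠ r ∧ t ≠ -r := by
      filter_upwards [compl_mem_ae_iff.2 (measure_singleton r),
        compl_mem_ae_iff.2 (measure_singleton (-r))]
        with t h1 h2
      exact ⟨h1, h2⟩
    refine integral_congr_ae (hne.mono fun t ht => ?_)
    by_cases hmem : t ∈ Set.Ioo (-r) r
    · have hpos : 0 < r ^ 2 - t ^ 2 := by nlinarith [hmem.1, hmem.2]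
      have h := integral_rieszWeight_sub_sqLen k N (Real.sqrt_pos.2 hpos)
      rw [Real.sq_sqrt hpos.le] at h
      simp only [Set.indicator_of_mem hmem, hG, h, mul_comm]
    · have hneg : r ^ 2 - t ^ 2 < 0 := by
        rcases lt_or_gt_of_ne ht.1 with h | h
        · have : t < -r := lt_of_le_of_ne (not_lt.1 fun h' => hmem ⟨h', h⟩) ht.2
          nlinarith
        · nlinarith
      have h : ∀ y : Fin k → ℝ, rieszWeight N (r ^ 2 - t ^ 2 - sqLen y) = 0 := fun y =>
        rieszWeight_of_neg _ (by linarith [sqLen_nonneg y])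
      simp only [Set.indicator_of_notMem hmem, h, integral_zero, Complex.ofReal_zero, zero_mul]
  rw [hrestrict]
  have hsub := intervalIntegral.integral_deriv_smul_comp
    (a := -(Real.pi / 2)) (b := Real.pi / 2) (f := fun θ => r * Real.sin θ)
    (f' := fun θ => r * Real.cos θ) (g := G)
    (fun θ _ => (Real.hasDerivAt_sin θ).const_mul r) (by fun_prop) hGc
  simp only [Real.sin_neg, Real.sin_pi_div_two, mul_neg, mul_one] at hsub
  rw [← hsub, oscInt, ← intervalIntegral.integral_const_mul]
  refine intervalIntegral.integral_congr fun θ hθ => ?_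
  rw [Set.uIcc_of_le (by linarith [Real.pi_pos])] at hθ
  have hcos := Real.cos_nonneg_of_mem_Icc hθ
  have hsqrt : √(r ^ 2 - (r * Real.sin θ) ^ 2) = r * Real.cos θ := by
    rw [show r ^ 2 - (r * Real.sin θ) ^ 2 = (r * Real.cos θ) ^ 2 by
      rw [mul_pow, mul_pow, Real.cos_sq']; ring]
    exact Real.sqrt_sq (by positivity)
  simp only [Function.comp, hG, hsqrt, sinPhase, pow_zero, mul_one, Complex.real_smul]
  rw [show -2 * Real.pi * (s * (r * Real.sin θ)) = -(2 * Real.pi * (s * r)) * Real.sin θ by ring]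
  push_cast
  ring

lemma exists_norm_rieszFourier_one_le (k N : ℕ) :
    ∃ C, ∀ r : ℝ, 1 ≤ r → ∀ ξ : Fin (k + 1) → ℝ, 1 ≤ √(sqLen ξ) →
      √(sqLen ξ) ^ N * √(√(sqLen ξ) * r) ^ (k + 2) * ‖rieszFourier (fun _ => 1) N r ξ‖
        ≤ C * r ^ (k + 1 + N) := by
  obtain ⟨C, hC⟩ := exists_norm_oscInt_le (2 * N + k + 1) 0
  refine ⟨rieszVolume (k) N * C, fun r hr ξ hξ => ?_⟩
  set s := √(sqLen ξ) with hs
  have hr0 : 0 < r := by linarith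
  have hs0 : 0 < s := by linarith
  have hsξ : sqLen ξ = sqLen (Fin.cons s 0 : Fin (k + 1) → ℝ) := by
    rw [sqLen_single, hs, Real.sq_sqrt (sqLen_nonneg _)]
  have hsr : 1 ≤ s * r := one_le_mul_of_one_le_of_one_le hξ hr
  have hσ : s * r ≤ 2 * Real.pi * (s * r) := by nlinarith [Real.pi_gt_three]
  rw [rieszFourier_one_eq_of_sqLen_eq N r hsξ, rieszFourier_one_cons k N hr0, norm_mul,
    Complex.norm_real, Real.norm_of_nonneg (by have := rieszVolume_nonneg k N; positivity)]
  have h := hC _ (hsr.trans hσ)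
  have h2 : √(s * r) ^ (2 * N + k + 1 + 1) ≤ √(2 * Real.pi * (s * r)) ^ (2 * N + k + 1 + 1) := by
    gcongr
  have h3 : √(s * r) ^ (2 * N + k + 1 + 1) = s ^ N * r ^ N * √(s * r) ^ (k + 2) := by
    rw [show 2 * N + k + 1 + 1 = 2 * N + (k + 2) by ring, pow_add, pow_mul,
      Real.sq_sqrt (by positivity), mul_pow]
  rw [h3] at h2
  have h4 := (mul_le_mul_of_nonneg_right h2 (norm_nonneg _)).trans h
  calc _ = rieszVolume k N * r ^ (k + 1 + N) * (s ^ N * r ^ N * √(s * r) ^ (k + 2)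
        * ‖oscInt (2 * N + k + 1) 0 (2 * Real.pi * (s * r))‖) := by ring
    _ ≤ rieszVolume k N * r ^ (k + 1 + N) * C :=
        mul_le_mul_of_nonneg_left h4 (by have := rieszVolume_nonneg k N; positivity)
    _ = _ := by ring

lemma hasDerivAt_eval_insertNth {k : ℕ} (j : Fin (k + 1)) (y : Fin k → ℝ)
    (p : MvPolynomial (Fin (k + 1)) ℝ) (t : ℝ) :
    HasDerivAt (fun t => MvPolynomial.eval (j.insertNth t y : Fin (k + 1) → ℝ) p)
      (MvPolynomial.eval (j.insertNth t y : Fin (k + 1) → ℝ) (MvPolynomial.pderiv j p)) t := by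
  induction p using MvPolynomial.induction_on with
  | C c => simpa using hasDerivAt_const t c
  | add p q hp hq =>
    simp only [map_add]
    exact hp.add hq
  | mul_X p i hp =>
    have hi : HasDerivAt (fun t => (j.insertNth t y : Fin (k + 1) → ℝ) i)
        (MvPolynomial.eval (j.insertNth t y : Fin (k + 1) → ℝ)
          (MvPolynomial.pderiv j (MvPolynomial.X i))) t := by
      rcases Fin.eq_self_or_eq_succAbove j i with rfl | ⟨i, rfl⟩
      · simp only [Fin.insertNth_apply_same, MvPolynomial.pderiv_X_self, map_one]
        exact hasDerivAt_id' t
      · rw [MvPolynomial.pderiv_X_of_ne (Fin.succAbove_ne j i)]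
        simpa using hasDerivAt_const t (y i)
    refine ((hp.mul hi).congr_deriv ?_).congr_of_eventuallyEq (.of_forall fun t => ?_)
    · simp only [Derivation.leibniz, map_add, smul_eq_mul, map_mul, MvPolynomial.eval_X]
      ring
    · simp

lemma hasDerivAt_planeWave_insertNth {k : ℕ} (j : Fin (k + 1)) (y : Fin k → ℝ)
    (ξ : Fin (k + 1) → ℝ) (t : ℝ) :
    HasDerivAt (fun t => planeWave ξ (j.insertNth t y))
      (-(2 * Real.pi * ξ j * Complex.I) * planeWave ξ (j.insertNth t y)) t := by
  have h : ∀ t : ℝ, -2 * Real.pi * ∑ i, ξ i * (j.insertNth t y : Fin (k + 1) → ℝ) i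
      = -2 * Real.pi * (ξ j * t + ∑ i, ξ (j.succAbove i) * y i) := fun t => by
    simp [Fin.sum_univ_succAbove _ j]
  simp only [planeWave, h]
  have h1 : HasDerivAt (fun t : ℝ => -2 * Real.pi * (ξ j * t + ∑ i, ξ (j.succAbove i) * y i))
      (-2 * Real.pi * (ξ j * 1)) t :=
    (((hasDerivAt_id t).const_mul (ξ j)).add_const _).const_mul _
  refine ((h1.ofReal_comp.mul_const Complex.I).cexp).congr_deriv ?_
  push_cast
  ring

lemma rieszFourier_X_mul {k : ℕ} (j : Fin (k + 1)) (p : MvPolynomial (Fin (k + 1)) ℝ)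
    (N : ℕ) (r : ℝ) (ξ : Fin (k + 1) → ℝ) :
    2 * rieszFourier (fun x => MvPolynomial.eval x (MvPolynomial.X j * p)) N r ξ
      = rieszFourier (fun x => MvPolynomial.eval x (MvPolynomial.pderiv j p)) (N + 1) r ξ
        - 2 * Real.pi * ξ j * Complex.I *
          rieszFourier (fun x => MvPolynomial.eval x p) (N + 1) r ξ := by
  have hcont : ∀ q : MvPolynomial (Fin (k + 1)) ℝ,
      Continuous fun x : Fin (k + 1) → ℝ => ((MvPolynomial.eval x q : ℝ) : ℂ) * planeWave ξ x :=
    fun q => (Complex.continuous_ofReal.comp (MvPolynomial.continuous_eval q)).mul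
      (continuous_planeWave ξ)
  set P : (Fin (k + 1) → ℝ) → ℂ := fun x => ((MvPolynomial.eval x p : ℝ) : ℂ) * planeWave ξ x
    with hP
  set Q : (Fin (k + 1) → ℝ) → ℂ := fun x =>
    ((MvPolynomial.eval x (MvPolynomial.pderiv j p) : ℝ) : ℂ) * planeWave ξ x
      - 2 * Real.pi * ξ j * Complex.I * P x with hQ
  set Z : (Fin (k + 1) → ℝ) → ℂ := fun x => ((-2 * x j : ℝ) : ℂ) * P x with hZ
  have hPc : Continuous P := hcont p
  have hQc : Continuous Q := (hcont _).sub (continuous_const.mul hPc)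
  have hZc : Continuous Z := by fun_prop
  have hderiv : ∀ (y : Fin k → ℝ) (t : ℝ),
      HasDerivAt (fun t => P (j.insertNth t y)) (Q (j.insertNth t y)) t := fun y t => by
    refine ((hasDerivAt_eval_insertNth j y p t).ofReal_comp.mul
      (hasDerivAt_planeWave_insertNth j y ξ t)).congr_deriv ?_
    simp only [hQ, hP]
    ring
  have hins : ∀ y : Fin k → ℝ, Continuous fun t : ℝ => (j.insertNth t y : Fin (k + 1) → ℝ) :=
    fun y => by fun_prop
  have hzero : ∫ x, (rieszWeight N (r ^ 2 - sqLen x) • Z x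
      + rieszWeight (N + 1) (r ^ 2 - sqLen x) • Q x) = 0 := by
    refine (integral_eq_integral_integral_insertNth' j
      ((integrable_rieszWeight_smul hZc _ _).add (integrable_rieszWeight_smul hQc _ _))).trans ?_
    refine integral_eq_zero_of_ae (.of_forall fun y => ?_)
    set c := r ^ 2 - sqLen y with hc
    have hsub : ∀ t : ℝ, r ^ 2 - sqLen (j.insertNth t y : Fin (k + 1) → ℝ) = c - t ^ 2 :=
      fun t => by rw [sqLen_insertNth, hc]; ring
    simp only [Pi.add_apply, hsub, Pi.zero_apply]
    have hint : Integrable fun t : ℝ => rieszWeight N (c - t ^ 2) • Z (j.insertNth t y)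
        + rieszWeight (N + 1) (c - t ^ 2) • Q (j.insertNth t y) :=
      (integrable_rieszWeight_sub_smul (by fun_prop) (isCompact_sq_le c)
        (hZc.comp (hins y)) _).add
      (integrable_rieszWeight_sub_smul (by fun_prop) (isCompact_sq_le c)
        (hQc.comp (hins y)) _)
    set R := √c + 1 with hR
    have hRpos : 0 < R := by positivity
    have hout : ∀ t : ℝ, R ≤ |t| → ∀ M, rieszWeight M (c - t ^ 2) = 0 := fun t ht M => by
      refine rieszWeight_of_neg _ (sub_neg.2 ?_)
      exact Real.lt_sq_of_sqrt_lt (lt_of_lt_of_le (by linarith) ht) |>.trans_eq (sq_abs t)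
    rw [← intervalIntegral.integral_eq_integral_of_support_subset (a := -R) (b := R)]
    · have hft := integral_eq_of_hasDerivAt_off_countable
        (fun t => rieszWeight (N + 1) (c - t ^ 2) • P (j.insertNth t y))
        (fun t => rieszWeight N (c - t ^ 2) • Z (j.insertNth t y)
          + rieszWeight (N + 1) (c - t ^ 2) • Q (j.insertNth t y)) (a := -R) (b := R)
        (s := {√c, -√c}) (Set.toFinite _).countable
        (Continuous.continuousOn (by fun_prop)) (fun t ht => ?_) hint.intervalIntegrable
      · rw [hft, hout R (le_abs_self R), hout (-R) (by rw [abs_neg]; exact le_abs_self R)]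
        simp
      · have hne : c - t ^ 2 ≠ 0 := fun h0 => by
          refine ht.2 ?_
          have : √c = |t| := by rw [sub_eq_zero.1 h0, Real.sqrt_sq_eq_abs]
          rw [this]
          rcases abs_choice t with h | h <;> simp [h]
        have h1 : HasDerivAt (fun t : ℝ => c - t ^ 2) (-(2 * t)) t := by
          simpa using (hasDerivAt_pow 2 t).const_sub c
        refine (((hasDerivAt_rieszWeight_succ N hne).comp t h1).smul
          (hderiv y t)).congr_deriv ?_
        simp only [hZ, Fin.insertNth_apply_same, Complex.real_smul, Function.comp]
        push_cast
        ring
    · intro t ht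
      by_contra hmem
      refine ht ?_
      have : R ≤ |t| := by
        by_contra! hlt
        exact hmem ⟨(abs_lt.1 hlt).1, (abs_lt.1 hlt).2.le⟩
      simp [hout t this]
  have hi : ∀ M, Integrable fun x : Fin (k + 1) → ℝ =>
      rieszWeight M (r ^ 2 - sqLen x) • P x := fun M => integrable_rieszWeight_smul hPc _ _
  rw [integral_add (integrable_rieszWeight_smul hZc _ _) (integrable_rieszWeight_smul hQc _ _)]
    at hzero
  have e1 : ∫ x, rieszWeight N (r ^ 2 - sqLen x) • Z x
      = -(2 * rieszFourier (fun x => MvPolynomial.eval x (MvPolynomial.X j * p)) N r ξ) := by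
    rw [rieszFourier, ← integral_const_mul, ← integral_neg]
    refine integral_congr_ae (.of_forall fun x => ?_)
    simp only [hZ, hP, map_mul, MvPolynomial.eval_X, Complex.real_smul]
    push_cast
    ring
  have e2 : ∫ x, rieszWeight (N + 1) (r ^ 2 - sqLen x) • Q x
      = rieszFourier (fun x => MvPolynomial.eval x (MvPolynomial.pderiv j p)) (N + 1) r ξ
        - 2 * Real.pi * ξ j * Complex.I *
          rieszFourier (fun x => MvPolynomial.eval x p) (N + 1) r ξ := by
    rw [rieszFourier, rieszFourier, ← integral_const_mul, ← integral_sub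
      (integrable_rieszWeight_smul (hcont _) _ _) ((hi _).const_mul _)]
    refine integral_congr_ae (.of_forall fun x => ?_)
    simp only [hQ, hP, Complex.real_smul]
    ring
  rw [e1, e2] at hzero
  linear_combination -hzero

lemma rieszFourier_add {n : ℕ} {p q : (Fin n → ℝ) → ℝ} (hp : Continuous p) (hq : Continuous q)
    (N : ℕ) (r : ℝ) (ξ : Fin n → ℝ) :
    rieszFourier (fun x => p x + q x) N r ξ = rieszFourier p N r ξ + rieszFourier q N r ξ := by
  rw [rieszFourier, rieszFourier, rieszFourier, ← integral_add
    (integrable_rieszWeight_smul (by fun_prop) _ _) (integrable_rieszWeight_smul (by fun_prop) _ _)]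
  refine integral_congr_ae (.of_forall fun x => ?_)
  simp only [Complex.real_smul]
  push_cast
  ring

lemma rieszFourier_const_mul {n : ℕ} (c : ℝ) (p : (Fin n → ℝ) → ℝ)
    (N : ℕ) (r : ℝ) (ξ : Fin n → ℝ) :
    rieszFourier (fun x => c * p x) N r ξ = c * rieszFourier p N r ξ := by
  rw [rieszFourier, rieszFourier, ← integral_const_mul]
  refine integral_congr_ae (.of_forall fun x => ?_)
  simp only [Complex.real_smul]
  push_cast
  ring

/-- The Fourier transforms of the Riesz weights times `p` decay as they do for a polynomial of
degree at most `l`. -/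
def HasRieszDecay {k : ℕ} (l : ℕ) (p : MvPolynomial (Fin (k + 1)) ℝ) : Prop :=
  ∀ N, ∃ C, 0 ≤ C ∧ ∀ r : ℝ, 1 ≤ r → ∀ ξ : Fin (k + 1) → ℝ, 1 ≤ √(sqLen ξ) →
    √(sqLen ξ) ^ N * √(√(sqLen ξ) * r) ^ (k + 2)
      * ‖rieszFourier (fun x => MvPolynomial.eval x p) N r ξ‖ ≤ C * r ^ (k + 1 + N + l)

namespace HasRieszDecay

variable {k l : ℕ} {p q : MvPolynomial (Fin (k + 1)) ℝ}

lemma mono (hp : HasRieszDecay l p) {l' : ℕ} (h : l ≤ l') : HasRieszDecay l' p := by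
  intro N
  obtain ⟨C, hC, H⟩ := hp N
  refine ⟨C, hC, fun r hr ξ hξ => (H r hr ξ hξ).trans ?_⟩
  gcongr

lemma add (hp : HasRieszDecay l p) (hq : HasRieszDecay l q) : HasRieszDecay l (p + q) := by
  intro N
  obtain ⟨C, hC, H⟩ := hp N
  obtain ⟨D, hD, K⟩ := hq N
  refine ⟨C + D, by positivity, fun r hr ξ hξ => ?_⟩
  simp only [map_add]
  rw [rieszFourier_add (MvPolynomial.continuous_eval p) (MvPolynomial.continuous_eval q)]
  have := mul_le_mul_of_nonneg_left (norm_add_le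
    (rieszFourier (fun x => MvPolynomial.eval x p) N r ξ)
    (rieszFourier (fun x => MvPolynomial.eval x q) N r ξ))
    (show 0 ≤ √(sqLen ξ) ^ N * √(√(sqLen ξ) * r) ^ (k + 2) by positivity)
  linarith [H r hr ξ hξ, K r hr ξ hξ]

lemma C_mul (hp : HasRieszDecay l p) (c : ℝ) : HasRieszDecay l (MvPolynomial.C c * p) := by
  intro N
  obtain ⟨C, hC, H⟩ := hp N
  refine ⟨|c| * C, by positivity, fun r hr ξ hξ => ?_⟩
  simp only [map_mul, MvPolynomial.eval_C]
  rw [rieszFourier_const_mul, norm_mul, Complex.norm_real, Real.norm_eq_abs]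
  calc _ = |c| * _ := mul_left_comm _ _ _
    _ ≤ |c| * _ := mul_le_mul_of_nonneg_left (H r hr ξ hξ) (abs_nonneg c)
    _ = _ := by ring

lemma one : HasRieszDecay 0 (1 : MvPolynomial (Fin (k + 1)) ℝ) := by
  intro N
  obtain ⟨C, H⟩ := exists_norm_rieszFourier_one_le k N
  refine ⟨|C|, abs_nonneg C, fun r hr ξ hξ => ?_⟩
  simp only [map_one]
  refine (H r hr ξ hξ).trans ?_
  rw [add_zero]
  gcongr
  exact le_abs_self C

lemma X_mul (hp : HasRieszDecay l p) (j : Fin (k + 1))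
    (hd : HasRieszDecay l (MvPolynomial.pderiv j p)) :
    HasRieszDecay (l + 1) (MvPolynomial.X j * p) := by
  intro N
  obtain ⟨C, hC, H⟩ := hp (N + 1)
  obtain ⟨D, hD, K⟩ := hd (N + 1)
  refine ⟨D + 2 * Real.pi * C, by positivity, fun r hr ξ hξ => ?_⟩
  set s := √(sqLen ξ) with hs
  set F := rieszFourier (fun x => MvPolynomial.eval x (MvPolynomial.X j * p)) N r ξ with hF
  set G := rieszFourier (fun x => MvPolynomial.eval x (MvPolynomial.pderiv j p)) (N + 1) r ξ
    with hG
  set E := rieszFourier (fun x => MvPolynomial.eval x p) (N + 1) r ξ with hE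
  have h : 2 * F = G - 2 * Real.pi * ξ j * Complex.I * E := rieszFourier_X_mul j p N r ξ
  have hj : |ξ j| ≤ s := Real.abs_le_sqrt (sq_le_sqLen ξ j)
  have h1 : ‖F‖ ≤ s * ‖G‖ + 2 * Real.pi * s * ‖E‖ := by
    have h2 : 2 * ‖F‖ ≤ ‖G‖ + 2 * Real.pi * |ξ j| * ‖E‖ := by
      calc 2 * ‖F‖ = ‖2 * F‖ := by simp
        _ ≤ _ := by
          rw [h]
          refine (norm_sub_le _ _).trans_eq ?_
          simp [abs_of_pos Real.pi_pos]
    have h3 : ‖G‖ ≤ s * ‖G‖ := le_mul_of_one_le_left (norm_nonneg _) hξ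
    have h4 : 2 * Real.pi * |ξ j| * ‖E‖ ≤ 2 * Real.pi * s * ‖E‖ := by gcongr
    linarith [norm_nonneg F]
  have hK := K r hr ξ hξ
  have hH := H r hr ξ hξ
  rw [← hs, ← hG] at hK
  rw [← hs, ← hE] at hH
  calc s ^ N * √(s * r) ^ (k + 2) * ‖F‖
      ≤ s ^ N * √(s * r) ^ (k + 2) * (s * ‖G‖ + 2 * Real.pi * s * ‖E‖) := by gcongr
    _ = s ^ (N + 1) * √(s * r) ^ (k + 2) * ‖G‖
        + 2 * Real.pi * (s ^ (N + 1) * √(s * r) ^ (k + 2) * ‖E‖) := by ring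
    _ ≤ D * r ^ (k + 1 + (N + 1) + l) + 2 * Real.pi * (C * r ^ (k + 1 + (N + 1) + l)) := by
        gcongr
    _ = _ := by ring

end HasRieszDecay

lemma hasRieszDecay_of_totalDegree_le {k : ℕ} (l : ℕ) (p : MvPolynomial (Fin (k + 1)) ℝ)
    (hp : p.totalDegree ≤ l) : HasRieszDecay l p := by
  induction l generalizing p with
  | zero =>
    rw [MvPolynomial.totalDegree_eq_zero_iff_eq_C.1 (Nat.le_zero.1 hp),
      ← mul_one (MvPolynomial.C _)]
    exact HasRieszDecay.one.C_mul _
  | succ l ih =>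
    have hsum : ∀ T : Finset (Fin (k + 1) →₀ ℕ), T ⊆ p.support →
        HasRieszDecay (l + 1) (∑ s ∈ T, MvPolynomial.monomial s (p.coeff s)) := by
      intro T hT
      refine Finset.sum_induction _ (HasRieszDecay (l + 1)) (fun _ _ h h' => h.add h')
        (ih 0 (by simp) |>.mono l.le_succ) fun s hs => ?_
      have hdeg : s.degree ≤ l + 1 := (MvPolynomial.le_totalDegree (hT hs)).trans hp
      rw [← mul_one (p.coeff s), ← MvPolynomial.C_mul_monomial]
      refine HasRieszDecay.C_mul ?_ _
      rcases eq_or_ne s 0 with rfl | hs0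
      · exact HasRieszDecay.one.mono (Nat.zero_le _)
      · obtain ⟨j, hj⟩ := Finsupp.ne_iff.1 hs0
        have hle : Finsupp.single j 1 ≤ s := by
          rw [Finsupp.single_le_iff]
          exact Nat.one_le_iff_ne_zero.2 hj
        obtain ⟨s', rfl⟩ := exists_add_of_le hle
        rw [map_add, Finsupp.degree_single] at hdeg
        have hs' : (MvPolynomial.monomial s' (1 : ℝ)).totalDegree ≤ l :=
          (MvPolynomial.totalDegree_monomial_le s' 1).trans (by
            change s'.degree ≤ l
            omega)
        rw [← one_mul (1 : ℝ), ← MvPolynomial.monomial_mul]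
        refine HasRieszDecay.X_mul (ih _ hs') j (ih _ ?_)
        rw [MvPolynomial.pderiv_monomial]
        refine (MvPolynomial.totalDegree_monomial_le _ _).trans ?_
        change Finsupp.degree _ ≤ l
        exact (Finsupp.degree_mono tsub_le_self).trans (by omega)
    rw [p.as_sum]
    exact hsum _ subset_rfl

lemma intervalIntegrable_fwdDiff {E : Type*} [NormedAddCommGroup E] (h : ℝ)
    {f : ℝ → E} (hf : ∀ a b, IntervalIntegrable f volume a b) (a b : ℝ) :
    IntervalIntegrable (fwdDiff h f) volume a b := by
  have h1 : IntervalIntegrable (fun s => f (s + h)) volume a b := by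
    simpa using (hf (a + h) (b + h)).comp_add_right h
  exact h1.sub (hf a b)

lemma intervalIntegrable_fwdDiff_iter {E : Type*} [NormedAddCommGroup E] (h : ℝ) (M : ℕ)
    {f : ℝ → E} (hf : ∀ a b, IntervalIntegrable f volume a b) :
    ∀ a b, IntervalIntegrable ((fwdDiff h)^[M] f) volume a b := by
  induction M generalizing f with
  | zero => exact hf
  | succ M ih =>
    rw [Function.iterate_succ_apply]
    exact ih (intervalIntegrable_fwdDiff h hf)

lemma fwdDiff_iter_integral {E : Type*} [NormedAddCommGroup E] [NormedSpace ℝ E] (h : ℝ) (M : ℕ)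
    {f : ℝ → E} (hf : ∀ a b, IntervalIntegrable f volume a b) (lam : ℝ) :
    ((fwdDiff h)^[M] fun t => ∫ s in t..(t + h), f s) lam
      = ∫ s in lam..(lam + h), ((fwdDiff h)^[M] f) s := by
  induction M generalizing f with
  | zero => rfl
  | succ M ih =>
    have hshift : ∀ a b, IntervalIntegrable (fun s => f (s + h)) volume a b := fun a b => by
      simpa using (hf (a + h) (b + h)).comp_add_right h
    have hd : ∀ a b, IntervalIntegrable (fwdDiff h f) volume a b :=
      fun a b => (hshift a b).sub (hf a b)
    rw [Function.iterate_succ_apply, Function.iterate_succ_apply, ← ih hd]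
    refine congrArg (fun F => ((fwdDiff h)^[M] F) lam) (funext fun t => ?_)
    simp only [fwdDiff]
    rw [intervalIntegral.integral_sub (hshift _ _) (hf _ _),
      intervalIntegral.integral_comp_add_right]

lemma norm_fwdDiff_iter_le {E : Type*} [NormedAddCommGroup E] {h : ℝ} (hh : 0 ≤ h) (M : ℕ)
    {f : ℝ → E} {lam B : ℝ} (hf : ∀ t ∈ Set.Icc lam (lam + M * h), ‖f t‖ ≤ B) :
    ‖((fwdDiff h)^[M] f) lam‖ ≤ 2 ^ M * B := by
  induction M generalizing f B with
  | zero => simpa using hf lam (by simp)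
  | succ M ih =>
    rw [Function.iterate_succ_apply, pow_succ, mul_assoc]
    push_cast at hf
    refine ih fun t ht => (norm_sub_le _ _).trans ?_
    have h1 := hf t ⟨ht.1, by linarith [ht.2]⟩
    have h2 := hf (t + h) ⟨by linarith [ht.1], by linarith [ht.2]⟩
    linarith

/-- A sequence of functions each of which is a primitive of the preceding one. -/
structure IsPrimitiveSeq {E : Type*} [NormedAddCommGroup E] [NormedSpace ℝ E]
    (U : ℕ → ℝ → E) : Prop where
  intervalIntegrable : ∀ N a b, IntervalIntegrable (U N) volume a b
  integral_eq : ∀ N a b, ∫ t in a..b, U N t = U (N + 1) b - U (N + 1) a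

namespace IsPrimitiveSeq

variable {E : Type*} [NormedAddCommGroup E] [NormedSpace ℝ E]

lemma fwdDiff_iter_succ {U : ℕ → ℝ → E} (hU : IsPrimitiveSeq U) (h : ℝ) (N : ℕ) (lam : ℝ) :
    ((fwdDiff h)^[N + 1] (U (N + 1))) lam = ∫ t in lam..(lam + h), ((fwdDiff h)^[N] (U N)) t := by
  rw [← fwdDiff_iter_integral h N (hU.intervalIntegrable N), Function.iterate_succ_apply]
  refine congrArg (fun F => ((fwdDiff h)^[N] F) lam) (funext fun t => ?_)
  rw [hU.integral_eq]
  rfl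

lemma norm_fwdDiff_iter_le {U : ℕ → ℝ → E} (hU : IsPrimitiveSeq U) {h : ℝ} (hh : 0 ≤ h) (N : ℕ)
    {lam B : ℝ} (hB : ∀ t ∈ Set.Icc lam (lam + N * h), ‖U 0 t‖ ≤ B) :
    ‖((fwdDiff h)^[N] (U N)) lam‖ ≤ h ^ N * B := by
  induction N generalizing lam with
  | zero => simpa using hB lam (by simp)
  | succ N ih =>
    rw [hU.fwdDiff_iter_succ]
    push_cast at hB
    refine (intervalIntegral.norm_integral_le_of_norm_le_const (C := h ^ N * B)
      fun t ht => ?_).trans_eq ?_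
    · rw [Set.uIoc_of_le (by linarith)] at ht
      exact ih fun u hu => hB u ⟨by linarith [ht.1, hu.1], by linarith [ht.2, hu.2]⟩
    · rw [add_sub_cancel_left, abs_of_nonneg hh]
      ring

lemma le_fwdDiff_iter {U : ℕ → ℝ → ℝ} (hU : IsPrimitiveSeq U) {h : ℝ} (hh : 0 ≤ h) (N : ℕ)
    {lam A B : ℝ} (hAB : ∀ t ∈ Set.Icc lam (lam + N * h), U 0 t ∈ Set.Icc A B) :
    ((fwdDiff h)^[N] (U N)) lam ∈ Set.Icc (h ^ N * A) (h ^ N * B) := by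
  induction N generalizing lam with
  | zero => simpa using hAB lam (by simp)
  | succ N ih =>
    push_cast at hAB
    have hi := intervalIntegrable_fwdDiff_iter h N (hU.intervalIntegrable N) lam (lam + h)
    have hmem : ∀ t ∈ Set.Icc lam (lam + h), ((fwdDiff h)^[N] (U N)) t
        ∈ Set.Icc (h ^ N * A) (h ^ N * B) := fun t ht =>
      ih fun u hu => hAB u ⟨by linarith [ht.1, hu.1], by linarith [ht.2, hu.2]⟩
    have h1 := intervalIntegral.integral_mono_on (by linarith)
      (intervalIntegrable_const (c := h ^ N * A)) hi fun t ht => (hmem t ht).1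
    have h2 := intervalIntegral.integral_mono_on (by linarith) hi
      (intervalIntegrable_const (c := h ^ N * B)) fun t ht => (hmem t ht).2
    rw [intervalIntegral.integral_const, add_sub_cancel_left, smul_eq_mul] at h1 h2
    rw [hU.fwdDiff_iter_succ, pow_succ']
    exact ⟨by linarith, by linarith⟩

end IsPrimitiveSeq

lemma isPrimitiveSeq_rieszWeight (y : ℝ) :
    IsPrimitiveSeq fun N lam => rieszWeight N (lam - y) where
  intervalIntegrable N a b :=
    ((monotone_rieszWeight N).comp fun _ _ h => sub_le_sub_right h y).intervalIntegrable
  integral_eq N a b := by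
    rw [intervalIntegral.integral_comp_sub_right (fun t => rieszWeight N t), integral_rieszWeight]

lemma rieszWeight_zero_mem (t : ℝ) : rieszWeight 0 t ∈ Set.Icc (0 : ℝ) 1 := by
  unfold rieszWeight
  split_ifs <;> simp

lemma rieszWeight_nonneg (N : ℕ) (t : ℝ) : 0 ≤ rieszWeight N t := by
  unfold rieszWeight
  split_ifs <;> positivity

lemma integrable_rieszWeight_prod {n : ℕ} {E : Type*} [NormedAddCommGroup E] [NormedSpace ℝ E]
    {g : (Fin n → ℝ) → E} (hg : Continuous g) (N : ℕ) (a b : ℝ) :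
    Integrable (fun z : ℝ × (Fin n → ℝ) => rieszWeight N (z.1 - sqLen z.2) • g z.2)
      ((volume.restrict (Set.uIoc a b)).prod volume) := by
  have : IsFiniteMeasure (volume.restrict (Set.uIoc a b)) := by
    rw [Set.uIoc]
    infer_instance
  have hb := (integrable_rieszWeight_smul hg N (max a b)).norm.comp_snd
    (volume.restrict (Set.uIoc a b))
  refine hb.mono' ?_ ?_
  · have : Measurable fun z : ℝ × (Fin n → ℝ) => rieszWeight N (z.1 - sqLen z.2) :=
      (measurable_rieszWeight N).comp
        (measurable_fst.sub (continuous_sqLen.measurable.comp measurable_snd))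
    exact this.aestronglyMeasurable.smul (hg.comp continuous_snd).aestronglyMeasurable
  · have hmem : ∀ᵐ z : ℝ × (Fin n → ℝ) ∂((volume.restrict (Set.uIoc a b)).prod volume),
        z.1 ∈ Set.uIoc a b :=
      Measure.quasiMeasurePreserving_fst.ae (ae_restrict_mem measurableSet_uIoc)
    filter_upwards [hmem] with z hz
    rw [norm_smul, norm_smul, Real.norm_of_nonneg (rieszWeight_nonneg _ _),
      Real.norm_of_nonneg (rieszWeight_nonneg _ _)]
    gcongr
    exact monotone_rieszWeight N (by linarith [hz.2])

lemma isPrimitiveSeq_integral {n : ℕ} {E : Type*} [NormedAddCommGroup E] [NormedSpace ℝ E]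
    [CompleteSpace E] {g : (Fin n → ℝ) → E} (hg : Continuous g) :
    IsPrimitiveSeq fun N lam => ∫ x, rieszWeight N (lam - sqLen x) • g x where
  intervalIntegrable N a b := by
    rw [intervalIntegrable_iff]
    exact (integrable_rieszWeight_prod hg N a b).integral_prod_left
  integral_eq N a b := by
    rw [← integral_sub (integrable_rieszWeight_smul hg _ _) (integrable_rieszWeight_smul hg _ _),
      intervalIntegral.intervalIntegral_eq_integral_uIoc,
      integral_integral_swap (integrable_rieszWeight_prod hg N a b), ← integral_smul]
    refine integral_congr_ae (.of_forall fun x => ?_)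
    dsimp only
    rw [integral_smul_const, ← smul_assoc, ← intervalIntegral.intervalIntegral_eq_integral_uIoc,
      (isPrimitiveSeq_rieszWeight (sqLen x)).integral_eq, sub_smul]

/-- The `N`-th difference, with step `h`, of the Riesz weight of order `N`: a smoothing of
`h ^ N` times the indicator function of `y ≤ lam`. -/
def smoothWeight (N : ℕ) (h lam y : ℝ) : ℝ :=
  ((fwdDiff h)^[N] fun t => rieszWeight N (t - y)) lam

lemma smoothWeight_eq_sum (N : ℕ) (h lam y : ℝ) :
    smoothWeight N h lam y = ∑ i ∈ range (N + 1),
      ((-1 : ℤ) ^ (N - i) * N.choose i) • rieszWeight N (lam + i • h - y) :=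
  fwdDiff_iter_eq_sum_shift _ _ _ _

@[fun_prop]
lemma continuous_smoothWeight (N : ℕ) (h lam : ℝ) : Continuous (smoothWeight (N + 1) h lam) := by
  simp only [funext (smoothWeight_eq_sum (N + 1) h lam)]
  fun_prop

lemma smoothWeight_mem {h : ℝ} (hh : 0 ≤ h) (N : ℕ) (lam y : ℝ) :
    smoothWeight N h lam y ∈ Set.Icc 0 (h ^ N) := by
  have := (isPrimitiveSeq_rieszWeight y).le_fwdDiff_iter hh N (lam := lam)
    fun t _ => rieszWeight_zero_mem _
  rwa [mul_zero, mul_one] at this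

lemma smoothWeight_of_le {h : ℝ} (hh : 0 ≤ h) (N : ℕ) {lam y : ℝ} (hy : y ≤ lam) :
    smoothWeight N h lam y = h ^ N := by
  have := (isPrimitiveSeq_rieszWeight y).le_fwdDiff_iter hh N (lam := lam) (A := 1) (B := 1)
    fun t ht => by
      rw [rieszWeight_of_nonneg _ (by linarith [ht.1])]
      simp
  simp only [mul_one, Set.Icc_self, Set.mem_singleton_iff] at this
  exact this

lemma smoothWeight_of_lt {h : ℝ} (hh : 0 ≤ h) (N : ℕ) {lam y : ℝ} (hy : lam + N * h < y) :
    smoothWeight N h lam y = 0 := by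
  have := (isPrimitiveSeq_rieszWeight y).le_fwdDiff_iter hh N (lam := lam) (A := 0) (B := 0)
    fun t ht => by
      rw [rieszWeight_of_neg _ (by linarith [ht.2])]
      simp
  simp only [mul_zero, Set.Icc_self, Set.mem_singleton_iff] at this
  exact this

lemma integral_smoothWeight_smul {n : ℕ} {E : Type*} [NormedAddCommGroup E] [NormedSpace ℝ E]
    {g : (Fin n → ℝ) → E} (hg : Continuous g) (N : ℕ) (h lam : ℝ) :
    ∫ x, smoothWeight N h lam (sqLen x) • g x
      = ((fwdDiff h)^[N] fun t => ∫ x, rieszWeight N (t - sqLen x) • g x) lam := by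
  rw [fwdDiff_iter_eq_sum_shift]
  simp only [smoothWeight_eq_sum, Finset.sum_smul, smul_assoc, ← Int.cast_smul_eq_zsmul ℝ]
  rw [integral_finsetSum _ fun i _ => by
    exact (integrable_rieszWeight_smul hg N _).smul (_ : ℝ)]
  exact Finset.sum_congr rfl fun i _ => integral_smul _ _

lemma HasRieszDecay.norm_integral_smoothWeight_le {k l : ℕ} {p : MvPolynomial (Fin (k + 1)) ℝ}
    (hp : HasRieszDecay l p) (N : ℕ) :
    ∃ C, 0 ≤ C ∧ ∀ r : ℝ, 1 ≤ r → ∀ h : ℝ, 0 ≤ h → h ≤ r ^ 2 → ∀ ξ : Fin (k + 1) → ℝ,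
      1 ≤ √(sqLen ξ) →
      √(√(sqLen ξ) * r) ^ (k + 2) * ‖∫ x, smoothWeight N h (r ^ 2) (sqLen x) •
          (((MvPolynomial.eval x p : ℝ) : ℂ) * planeWave ξ x)‖ ≤ C * r ^ (k + 1 + l) * h ^ N ∧
      √(√(sqLen ξ) * r) ^ (k + 2) * ‖∫ x, smoothWeight N h (r ^ 2) (sqLen x) •
          (((MvPolynomial.eval x p : ℝ) : ℂ) * planeWave ξ x)‖
        ≤ C * r ^ (k + 1 + l) * (r / √(sqLen ξ)) ^ N := by
  have key : ∀ M, ∃ C, 0 ≤ C ∧ ∀ r : ℝ, 1 ≤ r → ∀ h : ℝ, 0 ≤ h → h ≤ r ^ 2 →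
      ∀ ξ : Fin (k + 1) → ℝ, 1 ≤ √(sqLen ξ) → ∀ t ∈ Set.Icc (r ^ 2) (r ^ 2 + N * h),
      ‖∫ x, rieszWeight M (t - sqLen x) • (((MvPolynomial.eval x p : ℝ) : ℂ) * planeWave ξ x)‖
        ≤ C * r ^ (k + 1 + l) * (r / √(sqLen ξ)) ^ M / √(√(sqLen ξ) * r) ^ (k + 2) := by
    intro M
    obtain ⟨C, hC, H⟩ := hp M
    refine ⟨C * √(1 + N) ^ (k + 1 + M + l), by positivity,
      fun r hr h hh hhr ξ hξ t ht => ?_⟩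
    set s := √(sqLen ξ) with hs
    have hs0 : 0 < s := by linarith
    have hr0 : 0 < r := by linarith
    have ht0 : 0 ≤ t := (sq_nonneg r).trans ht.1
    have h1 : r ≤ √t := Real.le_sqrt_of_sq_le ht.1
    have h2 : √t ≤ √(1 + N) * r := by
      rw [← Real.sqrt_sq hr0.le, ← Real.sqrt_mul (by positivity)]
      refine Real.sqrt_le_sqrt (ht.2.trans ?_)
      nlinarith [mul_le_mul_of_nonneg_left hhr (Nat.cast_nonneg (α := ℝ) N)]
    have h3 := H (√t) (hr.trans h1) ξ hξ
    rw [← hs, rieszFourier, Real.sq_sqrt ht0] at h3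
    set F := ∫ x, rieszWeight M (t - sqLen x) •
      (((MvPolynomial.eval x p : ℝ) : ℂ) * planeWave ξ x)
    rw [le_div_iff₀ (by positivity), div_pow, mul_div_assoc', le_div_iff₀ (by positivity)]
    calc ‖F‖ * √(s * r) ^ (k + 2) * s ^ M = s ^ M * √(s * r) ^ (k + 2) * ‖F‖ := by ring
      _ ≤ s ^ M * √(s * √t) ^ (k + 2) * ‖F‖ := by gcongr
      _ ≤ C * √t ^ (k + 1 + M + l) := h3
      _ ≤ C * (√(1 + N) * r) ^ (k + 1 + M + l) := by gcongr
      _ = _ := by ring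
  obtain ⟨C, hC, H⟩ := key 0
  obtain ⟨D, hD, K⟩ := key N
  refine ⟨C + 2 ^ N * D, by positivity, fun r hr h hh hhr ξ hξ => ?_⟩
  have hg : Continuous fun x : Fin (k + 1) → ℝ =>
      ((MvPolynomial.eval x p : ℝ) : ℂ) * planeWave ξ x :=
    (Complex.continuous_ofReal.comp (MvPolynomial.continuous_eval p)).mul (continuous_planeWave ξ)
  rw [integral_smoothWeight_smul hg]
  have hpos : 0 < √(√(sqLen ξ) * r) ^ (k + 2) := by
    have : 0 < √(sqLen ξ) := by linarith
    have : 0 < r := by linarith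
    positivity
  have h0 := (isPrimitiveSeq_integral hg).norm_fwdDiff_iter_le hh N (lam := r ^ 2)
    fun t ht => H r hr h hh hhr ξ hξ t ht
  have h1 := norm_fwdDiff_iter_le hh N (lam := r ^ 2) fun t ht => K r hr h hh hhr ξ hξ t ht
  rw [pow_zero, mul_one, mul_div_assoc', le_div_iff₀ hpos] at h0
  rw [mul_div_assoc', le_div_iff₀ hpos] at h1
  have hr0 : 0 ≤ r := by linarith
  constructor
  · rw [mul_comm]
    refine h0.trans ?_
    have : 0 ≤ 2 ^ N * D * r ^ (k + 1 + l) * h ^ N := by positivity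
    linarith
  · rw [mul_comm]
    refine h1.trans ?_
    have : 0 ≤ C * r ^ (k + 1 + l) * (r / √(sqLen ξ)) ^ N := by positivity
    linarith

/-- The majorant `c ^ (β - 1)`, damped quadratically beyond `X`. -/
def cutoffPower (β X c : ℝ) : ℝ := c ^ (β - 1) * min 1 ((X / c) ^ 2)

lemma cutoffPower_nonneg {c : ℝ} (hc : 0 ≤ c) (β X : ℝ) : 0 ≤ cutoffPower β X c := by
  unfold cutoffPower
  positivity

lemma cutoffPower_le_of_le {β : ℝ} (hβ : β ≤ 1) {X c s : ℝ} (hX : 0 ≤ X) (hc : 0 < c)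
    (hcs : c ≤ s) : cutoffPower β X s ≤ cutoffPower β X c := by
  unfold cutoffPower
  have := Real.rpow_le_rpow_of_nonpos hc hcs (by linarith : β - 1 ≤ 0)
  have : 0 < s := hc.trans_le hcs
  gcongr

lemma sum_range_cutoffPower_le {β X : ℝ} (hβ : 0 < β) (hβ1 : β < 1) (hX : 1 ≤ X) (M : ℕ) :
    ∑ a ∈ range M, cutoffPower β X (a + 1)
      ≤ min (M : ℝ) X ^ β / β + 2 * X ^ (1 + β) * (1 / X - 1 / max ((M : ℝ) + 1) X) := by
  induction M with
  | zero =>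
    have hX0 : 0 < X := by linarith
    have : 1 / max ((0 : ℝ) + 1) X ≤ 1 / X := by rw [zero_add, max_eq_right hX]
    have h2 : 0 ≤ 2 * X ^ (1 + β) * (1 / X - 1 / max ((0 : ℝ) + 1) X) := by
      have := sub_nonneg.2 this
      positivity
    simp only [range_zero, sum_empty, Nat.cast_zero]
    have : 0 ≤ min (0 : ℝ) X ^ β / β := by
      rw [min_eq_left hX0.le]
      positivity
    linarith
  | succ M ih =>
    have hX0 : 0 < X := by linarith
    rw [sum_range_succ]
    push_cast
    set a : ℝ := (M : ℝ) + 1 with ha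
    have ha0 : 0 < a := by positivity
    have ha1 : 1 ≤ a := by rw [ha]; linarith [Nat.cast_nonneg (α := ℝ) M]
    have hM : (M : ℝ) = a - 1 := by rw [ha]; ring
    rcases le_or_gt a X with haX | haX
    · have hstep : cutoffPower β X a ≤ a ^ β / β - (a - 1) ^ β / β := by
        have hb := rpow_one_add_le_one_add_mul_self (s := -(1 / a)) (p := β)
          (by rw [neg_le_neg_iff, div_le_one ha0]; exact ha1) hβ.le hβ1.le
        have h1 : (a - 1) ^ β = a ^ β * (1 + -(1 / a)) ^ β := by
          rw [← Real.mul_rpow ha0.le (by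
            have := (div_le_one ha0).2 ha1
            linarith)]
          congr 1
          rw [mul_add, mul_neg, mul_one_div_cancel ha0.ne', mul_one, sub_eq_add_neg]
        have h2 : a ^ (β - 1) = a ^ β / a := Real.rpow_sub_one ha0.ne' β
        have h3 : cutoffPower β X a ≤ a ^ (β - 1) :=
          mul_le_of_le_one_right (by positivity) (min_le_left _ _)
        refine h3.trans ?_
        rw [h2, ← sub_div, le_div_iff₀ hβ, h1]
        have h4 := mul_le_mul_of_nonneg_left hb (Real.rpow_nonneg ha0.le β)
        have h5 : a ^ β * (1 + β * -(1 / a)) = a ^ β - a ^ β / a * β := by ring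
        linarith
      rw [hM, min_eq_left (by linarith)] at ih
      rw [min_eq_left haX]
      have h6 : 1 / max (a + 1) X ≤ 1 / max a X := by
        gcongr
        linarith
      have h7 : 2 * X ^ (1 + β) * (1 / X - 1 / max a X)
          ≤ 2 * X ^ (1 + β) * (1 / X - 1 / max (a + 1) X) := by gcongr
      have h8 : a - 1 + 1 = a := by ring
      linarith
    · have hstep : cutoffPower β X a ≤ 2 * X ^ (1 + β) * (1 / a - 1 / (a + 1)) := by
        have h1 : cutoffPower β X a ≤ X ^ (β - 1) * (X / a) ^ 2 := by
          unfold cutoffPower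
          have := Real.rpow_le_rpow_of_nonpos hX0 haX.le (by linarith : β - 1 ≤ 0)
          gcongr
          exact min_le_right _ _
        refine h1.trans ?_
        have h2 : X ^ (β - 1) * (X / a) ^ 2 = X ^ (1 + β) * (1 / a ^ 2) := by
          have h3 : X ^ (1 + β) = X ^ (β - 1) * X ^ 2 := by
            rw [← Real.rpow_add_natCast hX0.ne']
            congr 1
            push_cast
            ring
          rw [h3, div_pow, mul_assoc, mul_one_div]
        have h3 : 1 / a ^ 2 ≤ 2 * (1 / a - 1 / (a + 1)) := by
          rw [div_sub_div _ _ ha0.ne' (by positivity), mul_div_assoc',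
            div_le_div_iff₀ (by positivity) (by positivity)]
          nlinarith
        rw [h2]
        nlinarith [mul_le_mul_of_nonneg_left h3 (Real.rpow_nonneg hX0.le (1 + β))]
      have h4 : min (M : ℝ) X ^ β / β ≤ min a X ^ β / β := by
        gcongr
        linarith
      rw [max_eq_left haX.le] at ih
      rw [max_eq_left (by linarith)]
      linarith

lemma sum_range_cutoffPower_le_mul {β X : ℝ} (hβ : 0 < β) (hβ1 : β < 1) (hX : 1 ≤ X) (M : ℕ) :
    ∑ a ∈ range M, cutoffPower β X (a + 1) ≤ (1 / β + 2) * X ^ β := by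
  have hX0 : 0 < X := by linarith
  refine (sum_range_cutoffPower_le hβ hβ1 hX M).trans ?_
  have h1 : min (M : ℝ) X ^ β / β ≤ 1 / β * X ^ β := by
    rw [div_eq_inv_mul, one_div]
    gcongr
    exact min_le_right _ _
  have h2 : 2 * X ^ (1 + β) * (1 / X - 1 / max ((M : ℝ) + 1) X) ≤ 2 * X ^ (1 + β) * (1 / X) := by
    gcongr
    linarith [show 0 ≤ 1 / max ((M : ℝ) + 1) X by positivity]
  have h3 : 2 * X ^ (1 + β) * (1 / X) = 2 * X ^ β := by
    rw [Real.rpow_add hX0, Real.rpow_one]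
    field_simp
  linarith

lemma exists_sum_cutoffPower_int_le {β : ℝ} (hβ : 0 < β) (hβ1 : β < 1) :
    ∃ C, 0 ≤ C ∧ ∀ X : ℝ, 1 ≤ X → ∀ T : Finset ℤ,
      ∑ a ∈ T, cutoffPower β X (max 1 |(a : ℝ)|) ≤ C * X ^ β := by
  refine ⟨1 + 2 * (1 / β + 2), by positivity, fun X hX T => ?_⟩
  have hsum : Summable fun a : ℕ => cutoffPower β X (a + 1) :=
    summable_of_sum_range_le (fun a => cutoffPower_nonneg (by positivity) β X)
      (sum_range_cutoffPower_le_mul hβ hβ1 hX)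
  have hle : ∑' a : ℕ, cutoffPower β X (a + 1) ≤ (1 / β + 2) * X ^ β :=
    Real.tsum_le_of_sum_range_le (fun a => cutoffPower_nonneg (by positivity) β X)
      (sum_range_cutoffPower_le_mul hβ hβ1 hX)
  set f : ℤ → ℝ := fun a => cutoffPower β X (max 1 |(a : ℝ)|) with hf
  have hpos : ∀ a : ℕ, f (a + 1 : ℕ) = cutoffPower β X (a + 1) := fun a => by
    simp only [hf, Int.cast_natCast, Nat.abs_cast]
    push_cast
    rw [max_eq_right (by linarith [Nat.cast_nonneg (α := ℝ) a])]
  have hneg : ∀ a : ℕ, f (-((a : ℤ) + 1)) = cutoffPower β X (a + 1) := fun a => by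
    rw [← hpos]
    simp only [hf]
    push_cast
    rw [abs_neg]
  have h1 : HasSum (fun a : ℕ => f a) (f 0 + ∑' a : ℕ, cutoffPower β X (a + 1)) := by
    have := hsum.hasSum
    simp only [← hpos] at this
    have h := (hasSum_nat_add_iff (f := fun a : ℕ => f a) 1).1 this
    simp only [hpos] at h
    simpa [add_comm] using h
  have h2 : HasSum (fun a : ℕ => f (-((a : ℤ) + 1))) (∑' a : ℕ, cutoffPower β X (a + 1)) := by
    simp only [hneg]
    exact hsum.hasSum
  have h3 := h1.of_nat_of_neg_add_one h2
  have hf0 : f 0 ≤ X ^ β := by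
    have : f 0 ≤ 1 := by simp [hf, cutoffPower]
    exact this.trans (Real.one_le_rpow hX hβ.le)
  calc ∑ a ∈ T, f a ≤ _ := sum_le_hasSum T
        (fun a _ => cutoffPower_nonneg (le_trans zero_le_one (le_max_left _ _)) β X) h3
    _ ≤ _ := by linarith

lemma exists_sum_prod_cutoffPower_le (n : ℕ) {β : ℝ} (hβ : 0 < β) (hβ1 : β < 1) :
    ∃ C, 0 ≤ C ∧ ∀ X : ℝ, 1 ≤ X → ∀ T : Finset (Fin n → ℤ),
      ∑ ξ ∈ T, ∏ i, cutoffPower β X (max 1 |(ξ i : ℝ)|) ≤ C * (X ^ β) ^ n := by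
  obtain ⟨C, hC, H⟩ := exists_sum_cutoffPower_int_le hβ hβ1
  refine ⟨C ^ n, by positivity, fun X hX T => ?_⟩
  classical
  have hnn : ∀ a : ℤ, 0 ≤ cutoffPower β X (max 1 |(a : ℝ)|) := fun a =>
    cutoffPower_nonneg (le_trans zero_le_one (le_max_left _ _)) β X
  have hsub : T ⊆ Fintype.piFinset fun i => T.image fun ξ => ξ i := fun ξ hξ => by
    simp only [Fintype.mem_piFinset]
    exact fun i => mem_image_of_mem (fun ξ : Fin n → ℤ => ξ i) hξ
  calc ∑ ξ ∈ T, ∏ i, cutoffPower β X (max 1 |(ξ i : ℝ)|)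
      ≤ ∑ ξ ∈ Fintype.piFinset fun i => T.image fun ξ : Fin n → ℤ => ξ i,
        ∏ i, cutoffPower β X (max 1 |(ξ i : ℝ)|) :=
        sum_le_sum_of_subset_of_nonneg hsub fun ξ _ _ => prod_nonneg fun i _ => hnn _
    _ = ∏ i, ∑ a ∈ T.image fun ξ : Fin n → ℤ => ξ i, cutoffPower β X (max 1 |(a : ℝ)|) :=
        (prod_univ_sum (fun i => T.image fun ξ : Fin n → ℤ => ξ i)
          fun _ a => cutoffPower β X (max 1 |(a : ℝ)|)).symm
    _ ≤ ∏ _i : Fin n, C * X ^ β :=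
        Finset.prod_le_prod (fun i _ => sum_nonneg fun a _ => hnn a) fun i _ => H X hX _
    _ = _ := by simp [mul_pow]

lemma abs_le_sqrt_sqLen_latticePoint {n : ℕ} (ξ : Fin n → ℤ) (i : Fin n) :
    |(ξ i : ℝ)| ≤ √(sqLen (latticePoint ξ)) :=
  Real.abs_le_sqrt (sq_le_sqLen (latticePoint ξ) i)

lemma one_le_sqrt_sqLen_latticePoint {n : ℕ} {ξ : Fin n → ℤ} (hξ : ξ ≠ 0) :
    1 ≤ √(sqLen (latticePoint ξ)) := by
  obtain ⟨i, hi⟩ := Function.ne_iff.1 hξ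
  refine le_trans ?_ (abs_le_sqrt_sqLen_latticePoint ξ i)
  exact_mod_cast Int.one_le_abs hi

lemma HasRieszDecay.norm_integral_smoothWeight_le_prod {k l : ℕ}
    {p : MvPolynomial (Fin (k + 1)) ℝ} (hp : HasRieszDecay l p) :
    ∃ C, 0 ≤ C ∧ ∀ r : ℝ, 1 ≤ r → ∀ h : ℝ, 0 < h → h ≤ r → ∀ ξ : Fin (k + 1) → ℤ, ξ ≠ 0 →
      ‖∫ x, smoothWeight (2 * k + 2) h (r ^ 2) (sqLen x) •
          (((MvPolynomial.eval x p : ℝ) : ℂ) * planeWave (latticePoint ξ) x)‖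
        ≤ C * r ^ (k + 1 + l) * h ^ (2 * k + 2) / √r ^ (k + 2) *
          ∏ i, cutoffPower (k / (2 * (k + 1))) (r / h) (max 1 |(ξ i : ℝ)|) := by
  obtain ⟨C, hC, H⟩ := hp.norm_integral_smoothWeight_le (2 * k + 2)
  refine ⟨C, hC, fun r hr h hh hhr ξ hξ => ?_⟩
  set β : ℝ := k / (2 * (k + 1)) with hβ
  have hβ1 : β ≤ 1 := by
    rw [hβ, div_le_one (by positivity)]
    linarith [Nat.cast_nonneg (α := ℝ) k]
  have hs := one_le_sqrt_sqLen_latticePoint hξ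
  obtain ⟨h1, h2⟩ := H r hr h hh.le (hhr.trans (by nlinarith)) (latticePoint ξ) hs
  have hmax : ∀ i, max 1 |(ξ i : ℝ)| ≤ √(sqLen (latticePoint ξ)) := fun i =>
    max_le hs (abs_le_sqrt_sqLen_latticePoint ξ i)
  set s := √(sqLen (latticePoint ξ)) with hsdef
  set W := ‖∫ x, smoothWeight (2 * k + 2) h (r ^ 2) (sqLen x) •
          (((MvPolynomial.eval x p : ℝ) : ℂ) * planeWave (latticePoint ξ) x)‖
  have hs0 : 0 < s := by linarith
  have hr0 : 0 < r := by linarith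
  have hprod : cutoffPower β (r / h) s ^ (k + 1)
      ≤ ∏ i, cutoffPower β (r / h) (max 1 |(ξ i : ℝ)|) := by
    have : ∏ _i : Fin (k + 1), cutoffPower β (r / h) s = cutoffPower β (r / h) s ^ (k + 1) := by
      simp
    rw [← this]
    exact Finset.prod_le_prod (fun _ _ => cutoffPower_nonneg hs0.le _ _) fun i _ =>
      cutoffPower_le_of_le hβ1 (by positivity) (by positivity) (hmax i)
  refine le_trans ?_ (mul_le_mul_of_nonneg_left hprod (by positivity))
  have hpow : (s ^ (β - 1)) ^ (k + 1) = 1 / √s ^ (k + 2) := by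
    rw [Real.sqrt_eq_rpow, ← Real.rpow_mul_natCast hs0.le, ← Real.rpow_mul_natCast hs0.le,
      one_div, ← Real.rpow_neg hs0.le]
    congr 1
    rw [hβ]
    push_cast
    field_simp
    ring
  rw [cutoffPower, mul_pow, hpow, div_mul_eq_mul_div, le_div_iff₀ (by positivity),
    mul_comm (1 / _), mul_one_div, mul_div_assoc', le_div_iff₀ (by positivity)]
  rw [Real.sqrt_mul hs0.le, mul_pow] at h1 h2
  rcases min_choice (1 : ℝ) ((r / h / s) ^ 2) with hmin | hmin
  · rw [hmin]
    calc _ = _ := by ring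
      _ ≤ _ := h1
      _ = _ := by ring
  · rw [hmin]
    calc _ = _ := by ring
      _ ≤ _ := h2
      _ = C * r ^ (k + 1 + l) * h ^ (2 * k + 2) * (r / h / s) ^ (2 * k + 2) := by
        rw [div_right_comm r h s, div_pow (r / s) h]
        field_simp
      _ = _ := by rw [← pow_mul, mul_add 2 k 1, mul_one]

lemma summable_of_sqLen {n : ℕ} {F : (Fin n → ℤ) → ℝ} (lam : ℝ)
    (hF : ∀ b, lam < sqLen (latticePoint b) → F b = 0) : Summable F := by
  refine summable_of_ne_finset_zero (s := latticeCube n (√lam)) fun b hb => hF b ?_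
  by_contra! h
  exact hb (mem_latticeCube ((norm_le_sqrt_sqLen _).trans (Real.sqrt_le_sqrt h)))

lemma HasRieszDecay.abs_tsum_sub_integral_le {k l : ℕ} (hk : 0 < k)
    {p : MvPolynomial (Fin (k + 1)) ℝ} (hp : HasRieszDecay l p) :
    ∃ C, 0 ≤ C ∧ ∀ r : ℝ, 1 ≤ r → ∀ h : ℝ, 0 < h → h ≤ r →
      |∑' b : Fin (k + 1) → ℤ, smoothWeight (2 * k + 2) h (r ^ 2) (sqLen (latticePoint b))
          * MvPolynomial.eval (latticePoint b) p
        - ∫ x, smoothWeight (2 * k + 2) h (r ^ 2) (sqLen x) * MvPolynomial.eval x p|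
        ≤ C * r ^ (k + l) / √h ^ k * h ^ (2 * k + 2) := by
  obtain ⟨C, hC, H⟩ := hp.norm_integral_smoothWeight_le_prod
  set β : ℝ := k / (2 * (k + 1)) with hβ
  have hk' : (0 : ℝ) < k := by exact_mod_cast hk
  have hβ0 : 0 < β := by positivity
  have hβ1 : β < 1 := by
    rw [hβ, div_lt_one (by positivity)]
    linarith
  obtain ⟨D, hD, K⟩ := exists_sum_prod_cutoffPower_le (k + 1) hβ0 hβ1
  refine ⟨C * D, by positivity, fun r hr h hh hhr => ?_⟩
  have hr0 : 0 < r := by linarith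
  have hX : 1 ≤ r / h := (one_le_div hh).2 hhr
  set A := C * r ^ (k + 1 + l) * h ^ (2 * k + 2) / √r ^ (k + 2) with hA
  have hA0 : 0 ≤ A := by positivity
  set φ : (Fin (k + 1) → ℤ) → ℝ := fun ξ => ∏ i, cutoffPower β (r / h) (max 1 |(ξ i : ℝ)|) with hφ
  have hφ0 : ∀ ξ, 0 ≤ φ ξ := fun ξ =>
    prod_nonneg fun i _ => cutoffPower_nonneg (le_trans zero_le_one (le_max_left _ _)) _ _
  have hφs : Summable φ := summable_of_sum_le hφ0 (K _ hX)
  have hφt : ∑' ξ, φ ξ ≤ D * ((r / h) ^ β) ^ (k + 1) := hφs.tsum_le_of_sum_le (K _ hX)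
  set f : (Fin (k + 1) → ℝ) → ℂ := fun x =>
    ((smoothWeight (2 * k + 2) h (r ^ 2) (sqLen x) * MvPolynomial.eval x p : ℝ) : ℂ) with hf
  have hfc : Continuous f := by
    refine Complex.continuous_ofReal.comp (Continuous.mul ?_ (MvPolynomial.continuous_eval p))
    exact (continuous_smoothWeight (2 * k + 1) h _).comp continuous_sqLen
  have hf0 : ∀ x, √(r ^ 2 + (2 * k + 2 : ℕ) * h) < ‖x‖ → f x = 0 := fun x hx => by
    have : r ^ 2 + (2 * k + 2 : ℕ) * h < sqLen x :=
      (Real.sqrt_lt_sqrt_iff (by positivity)).1 (hx.trans_le (norm_le_sqrt_sqLen x))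
    simp [hf, smoothWeight_of_lt hh.le _ this]
  set a : (Fin (k + 1) → ℤ) → ℂ := fun ξ => ∫ x, planeWave (latticePoint ξ) x * f x with ha
  have hbound : ∀ ξ, ξ ≠ 0 → ‖a ξ‖ ≤ A * φ ξ := fun ξ hξ => by
    refine le_of_eq_of_le ?_ (H r hr h hh hhr ξ hξ)
    congr 1
    refine integral_congr_ae (.of_forall fun x => ?_)
    simp only [hf, Complex.real_smul]
    push_cast
    ring
  have hsum : Summable a := (hφs.mul_left A).of_norm_bounded_eventually <| by
    rw [Filter.eventually_cofinite]
    refine (Set.finite_singleton (0 : Fin (k + 1) → ℤ)).subset fun ξ hξ => ?_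
    by_contra h0
    exact hξ (hbound ξ h0)
  have hP := hasSum_fourier_latticePoint hfc hf0 hsum
  have hite := hasSum_ite_sub_hasSum hP 0
  have hle := tsum_of_norm_bounded (hφs.mul_left A).hasSum (f := fun ξ => if ξ = 0 then 0 else a ξ)
    fun ξ => by
      by_cases h0 : ξ = 0
      · simpa [h0] using mul_nonneg hA0 (hφ0 0)
      · simpa [h0] using hbound ξ h0
  rw [hite.tsum_eq, tsum_mul_left] at hle
  have hreal : ∑' b : Fin (k + 1) → ℤ, f (latticePoint b) - ∫ x, planeWave (latticePoint 0) x * f x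
      = ((∑' b : Fin (k + 1) → ℤ, smoothWeight (2 * k + 2) h (r ^ 2) (sqLen (latticePoint b))
          * MvPolynomial.eval (latticePoint b) p
        - ∫ x, smoothWeight (2 * k + 2) h (r ^ 2) (sqLen x) * MvPolynomial.eval x p : ℝ) : ℂ) := by
    have h0 : latticePoint (0 : Fin (k + 1) → ℤ) = 0 := by
      ext i
      simp [latticePoint]
    rw [Complex.ofReal_sub, Complex.ofReal_tsum, ← integral_complex_ofReal]
    simp only [h0, planeWave_zero, one_mul, hf]
  rw [hreal, Complex.norm_real, Real.norm_eq_abs] at hle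
  refine hle.trans ((mul_le_mul_of_nonneg_left hφt hA0).trans_eq ?_)
  have hpow : ((r / h) ^ β) ^ (k + 1) = √r ^ k / √h ^ k := by
    rw [← div_pow, ← Real.sqrt_div hr0.le, Real.sqrt_eq_rpow,
      ← Real.rpow_mul_natCast (by positivity), ← Real.rpow_mul_natCast (by positivity)]
    congr 1
    rw [hβ]
    push_cast
    field_simp
  rw [hpow, hA, pow_add (√r) k 2, Real.sq_sqrt hr0.le]
  have : 0 < √r := Real.sqrt_pos.2 hr0
  field_simp
  ring

/-- The sum of `p` over the lattice points `b` with `|b|² ≤ t`. -/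
def ballSum {n : ℕ} (p : MvPolynomial (Fin n) ℝ) (t : ℝ) : ℝ :=
  ∑' b : Fin n → ℤ,
    rieszWeight 0 (t - sqLen (latticePoint b)) * MvPolynomial.eval (latticePoint b) p

/-- The integral of `p` over the ball `|x|² ≤ t`. -/
def ballIntegral {n : ℕ} (p : MvPolynomial (Fin n) ℝ) (t : ℝ) : ℝ :=
  ∫ x : Fin n → ℝ, rieszWeight 0 (t - sqLen x) * MvPolynomial.eval x p

variable {n : ℕ} {p : MvPolynomial (Fin n) ℝ}

lemma integrable_ballIntegral (p : MvPolynomial (Fin n) ℝ) (t : ℝ) :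
    Integrable fun x : Fin n → ℝ => rieszWeight 0 (t - sqLen x) * MvPolynomial.eval x p :=
  integrable_rieszWeight_smul (MvPolynomial.continuous_eval p) 0 t

lemma summable_ballSum (p : MvPolynomial (Fin n) ℝ) (t : ℝ) :
    Summable fun b : Fin n → ℤ =>
      rieszWeight 0 (t - sqLen (latticePoint b)) * MvPolynomial.eval (latticePoint b) p :=
  summable_of_sqLen t fun b hb => by rw [rieszWeight_of_neg _ (sub_neg.2 hb), zero_mul]

lemma monotone_ballSum (hp : ∀ x, 0 ≤ MvPolynomial.eval x p) : Monotone (ballSum p) :=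
  fun s t hst => (summable_ballSum p s).tsum_le_tsum (fun b =>
    mul_le_mul_of_nonneg_right (monotone_rieszWeight 0 (by linarith)) (hp _)) (summable_ballSum p t)

lemma monotone_ballIntegral (hp : ∀ x, 0 ≤ MvPolynomial.eval x p) : Monotone (ballIntegral p) :=
  fun s t hst => integral_mono (integrable_ballIntegral p s) (integrable_ballIntegral p t) fun x =>
    mul_le_mul_of_nonneg_right (monotone_rieszWeight 0 (by linarith)) (hp x)

lemma ballIntegral_nonneg (hp : ∀ x, 0 ≤ MvPolynomial.eval x p) (t : ℝ) : 0 ≤ ballIntegral p t :=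
  integral_nonneg fun x => mul_nonneg (rieszWeight_nonneg _ _) (hp x)

lemma ballIntegral_sq {l : ℕ} (hp : ∀ (c : ℝ) x,
    MvPolynomial.eval (c • x) p = c ^ l * MvPolynomial.eval x p) {c : ℝ} (hc : 0 < c) :
    ballIntegral p (c ^ 2) = ballIntegral p 1 * c ^ (n + l) := by
  have h := Measure.integral_comp_smul volume
    (fun y : Fin n → ℝ => rieszWeight 0 (c ^ 2 - sqLen y) * MvPolynomial.eval y p) c
  have e : ∀ y : Fin n → ℝ, rieszWeight 0 (c ^ 2 - sqLen (c • y)) * MvPolynomial.eval (c • y) p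
      = c ^ l * (rieszWeight 0 (1 - sqLen y) * MvPolynomial.eval y p) := fun y => by
    rw [sqLen_smul, hp, show c ^ 2 - c ^ 2 * sqLen y = c ^ 2 * (1 - sqLen y) by ring,
      rieszWeight_mul (by positivity)]
    ring
  simp only [e, integral_const_mul, Module.finrank_fintype_fun_eq_card, Fintype.card_fin,
    smul_eq_mul] at h
  rw [abs_of_pos (by positivity), ← div_eq_inv_mul, eq_div_iff (by positivity)] at h
  rw [ballIntegral, ← h, ballIntegral]
  ring

lemma smoothWeight_mem_rieszWeight {h : ℝ} (hh : 0 ≤ h) (N : ℕ) (lam y : ℝ) :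
    smoothWeight N h lam y
      ∈ Set.Icc (h ^ N * rieszWeight 0 (lam - y)) (h ^ N * rieszWeight 0 (lam + N * h - y)) := by
  have hmem := smoothWeight_mem hh N lam y
  have hN : 0 ≤ h ^ N := by positivity
  constructor
  · rcases le_or_gt y lam with hy | hy
    · rw [smoothWeight_of_le hh N hy]
      exact mul_le_of_le_one_right hN (rieszWeight_zero_mem _).2
    · rw [rieszWeight_of_neg _ (sub_neg.2 hy), mul_zero]
      exact hmem.1
  · rcases le_or_gt y (lam + N * h) with hy | hy
    · rw [rieszWeight_of_nonneg _ (sub_nonneg.2 hy)]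
      simpa using hmem.2
    · rw [smoothWeight_of_lt hh N hy]
      exact mul_nonneg hN (rieszWeight_nonneg _ _)

lemma tsum_smoothWeight_mem (hp : ∀ x, 0 ≤ MvPolynomial.eval x p) {h : ℝ} (hh : 0 ≤ h) (N : ℕ)
    (lam : ℝ) :
    ∑' b : Fin n → ℤ, smoothWeight N h lam (sqLen (latticePoint b))
        * MvPolynomial.eval (latticePoint b) p
      ∈ Set.Icc (h ^ N * ballSum p lam) (h ^ N * ballSum p (lam + N * h)) := by
  have hs : Summable fun b : Fin n → ℤ => smoothWeight N h lam (sqLen (latticePoint b))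
      * MvPolynomial.eval (latticePoint b) p :=
    summable_of_sqLen (lam + N * h) fun b hb => by rw [smoothWeight_of_lt hh N hb, zero_mul]
  rw [ballSum, ballSum, ← tsum_mul_left, ← tsum_mul_left]
  constructor
  · refine ((summable_ballSum p _).mul_left _).tsum_le_tsum (fun b => ?_) hs
    rw [← mul_assoc]
    exact mul_le_mul_of_nonneg_right (smoothWeight_mem_rieszWeight hh N lam _).1 (hp _)
  · refine hs.tsum_le_tsum (fun b => ?_) ((summable_ballSum p _).mul_left _)
    rw [← mul_assoc]
    exact mul_le_mul_of_nonneg_right (smoothWeight_mem_rieszWeight hh N lam _).2 (hp _)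

lemma integral_smoothWeight_mem (hp : ∀ x, 0 ≤ MvPolynomial.eval x p) {h : ℝ} (hh : 0 ≤ h)
    (N : ℕ) (lam : ℝ) :
    ∫ x : Fin n → ℝ, smoothWeight (N + 1) h lam (sqLen x) * MvPolynomial.eval x p
      ∈ Set.Icc (h ^ (N + 1) * ballIntegral p lam)
        (h ^ (N + 1) * ballIntegral p (lam + (N + 1 : ℕ) * h)) := by
  have hb := fun x : Fin n → ℝ => smoothWeight_mem_rieszWeight hh (N + 1) lam (sqLen x)
  have hs : Integrable fun x : Fin n → ℝ =>
      smoothWeight (N + 1) h lam (sqLen x) * MvPolynomial.eval x p := by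
    refine ((integrable_ballIntegral p (lam + (N + 1 : ℕ) * h)).const_mul (h ^ (N + 1))).mono'
      (Continuous.aestronglyMeasurable ?_) (.of_forall fun x => ?_)
    · exact ((continuous_smoothWeight N h lam).comp continuous_sqLen).mul
        (MvPolynomial.continuous_eval p)
    · rw [Real.norm_of_nonneg (mul_nonneg (smoothWeight_mem hh _ _ _).1 (hp x)), ← mul_assoc]
      exact mul_le_mul_of_nonneg_right (hb x).2 (hp x)
  rw [ballIntegral, ballIntegral, ← integral_const_mul, ← integral_const_mul]
  constructor
  · refine integral_mono ((integrable_ballIntegral p _).const_mul _) hs fun x => ?_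
    simp only [← mul_assoc]
    exact mul_le_mul_of_nonneg_right (hb x).1 (hp x)
  · refine integral_mono hs ((integrable_ballIntegral p _).const_mul _) fun x => ?_
    simp only [← mul_assoc]
    exact mul_le_mul_of_nonneg_right (hb x).2 (hp x)

lemma HasRieszDecay.ballSum_le_and_le {k l : ℕ} (hk : 0 < k) {p : MvPolynomial (Fin (k + 1)) ℝ}
    (hp : HasRieszDecay l p) (hp0 : ∀ x, 0 ≤ MvPolynomial.eval x p) :
    ∃ C, 0 ≤ C ∧ ∀ r : ℝ, 1 ≤ r → ∀ h : ℝ, 0 < h → h ≤ r →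
      ballSum p (r ^ 2) ≤ ballIntegral p (r ^ 2 + (2 * k + 2 : ℕ) * h) + C * r ^ (k + l) / √h ^ k ∧
      ballIntegral p (r ^ 2) - C * r ^ (k + l) / √h ^ k
        ≤ ballSum p (r ^ 2 + (2 * k + 2 : ℕ) * h) := by
  obtain ⟨C, hC, H⟩ := hp.abs_tsum_sub_integral_le hk
  refine ⟨C, hC, fun r hr h hh hhr => ?_⟩
  have h1 := abs_le.1 (H r hr h hh hhr)
  have h2 := tsum_smoothWeight_mem hp0 hh.le (2 * k + 2) (r ^ 2)
  have h3 := integral_smoothWeight_mem hp0 hh.le (2 * k + 1) (r ^ 2)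
  have hN : 0 < h ^ (2 * k + 2) := by positivity
  constructor <;> refine le_of_mul_le_mul_left ?_ hN
  · linarith [h1.2, h2.1, h3.2]
  · linarith [h1.1, h2.2, h3.1]

lemma abs_add_pow_sub_pow_le (m : ℕ) {R δ : ℝ} (hR : 0 ≤ R) (hδ : |δ| ≤ R) :
    |(R + δ) ^ (m + 1) - R ^ (m + 1)| ≤ (m + 1) * 2 ^ m * (|δ| * R ^ m) := by
  refine (abs_pow_sub_pow_le (R + δ) R (m + 1)).trans ?_
  have h1 : max |R + δ| |R| ≤ 2 * R :=
    max_le ((abs_add_le _ _).trans (by rw [abs_of_nonneg hR]; linarith))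
      (by rw [abs_of_nonneg hR]; linarith)
  rw [add_sub_cancel_left, Nat.add_sub_cancel]
  calc _ ≤ |δ| * (m + 1 : ℕ) * (2 * R) ^ m := by gcongr
    _ = _ := by push_cast; ring

lemma HasRieszDecay.abs_ballSum_sub_le {k l : ℕ} (hk : 0 < k) {p : MvPolynomial (Fin (k + 1)) ℝ}
    (hp : HasRieszDecay l p) (hp0 : ∀ x, 0 ≤ MvPolynomial.eval x p)
    (hpl : ∀ (c : ℝ) x, MvPolynomial.eval (c • x) p = c ^ l * MvPolynomial.eval x p) :
    ∃ C, 0 ≤ C ∧ ∀ u : ℝ, 2 * k + 2 ≤ u → ∀ R, R = u ^ (k + 2) →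
      |ballSum p (R ^ 2) - ballIntegral p 1 * R ^ (k + 1 + l)| ≤ C * (R ^ (k + l) / u ^ k) := by
  obtain ⟨C, hC, H⟩ := hp.ballSum_le_and_le hk hp0
  have hV := ballIntegral_nonneg hp0 1
  set V := ballIntegral p 1 with hVdef
  refine ⟨V * ((k + l + 1) * 2 ^ (k + l) * (k + 1)) + C * √2 ^ k, by positivity,
    fun u hu R hR => ?_⟩
  have hk0 : (0 : ℝ) ≤ k := by positivity
  have hu1 : 1 ≤ u := by linarith
  have hu0 : 0 < u := by linarith
  have huk : 1 ≤ u ^ k := one_le_pow₀ hu1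
  have hu2 : 1 ≤ u ^ 2 := one_le_pow₀ hu1
  have hRk : R = u ^ k * u ^ 2 := by rw [hR, pow_add]
  have hRu2 : u ^ 2 ≤ R := by rw [hRk]; nlinarith
  have hRN : 2 * k + 2 ≤ R := by nlinarith
  have hR0 : 0 < R := by linarith
  set h := u ^ 2 / 2 with hh
  have hh0 : 0 < h := by positivity
  set δ : ℝ := (k + 1) / u ^ k with hδ
  have hδ0 : 0 < δ := by positivity
  have hδR : δ ≤ R / 2 := by
    rw [hδ]
    refine (div_le_self (by positivity) huk).trans (by linarith)
  have hδh : δ * R = (2 * k + 2 : ℕ) * h := by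
    rw [hδ, hh, hRk]
    push_cast
    field_simp
  have hsq : √h ^ k = u ^ k / √2 ^ k := by
    rw [hh, Real.sqrt_div (by positivity), Real.sqrt_sq hu0.le, div_pow]
  have herr : ∀ r, 0 ≤ r → r ≤ R →
      C * r ^ (k + l) / √h ^ k ≤ C * √2 ^ k * (R ^ (k + l) / u ^ k) := fun r hr0 hrR => by
    rw [hsq, div_div_eq_mul_div]
    calc _ ≤ C * R ^ (k + l) * √2 ^ k / u ^ k := by gcongr
      _ = _ := by ring
  have hpow : ∀ η, |η| = δ → |(R + η) ^ (k + l + 1) - R ^ (k + l + 1)|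
      ≤ (k + l + 1) * 2 ^ (k + l) * (k + 1) * (R ^ (k + l) / u ^ k) := fun η hη => by
    refine (abs_add_pow_sub_pow_le (k + l) hR0.le (by rw [hη]; linarith)).trans_eq ?_
    rw [hη, hδ]
    push_cast
    ring
  have hup := abs_le.1 (hpow δ (abs_of_pos hδ0))
  have hlo := abs_le.1 (hpow (-δ) (by rw [abs_neg, abs_of_pos hδ0]))
  have h1 := (H R (by linarith) h hh0 (by linarith)).1
  have h2 := (H (R + -δ) (by linarith) h hh0 (by linarith)).2
  have h3 : ballIntegral p (R ^ 2 + (2 * k + 2 : ℕ) * h) ≤ V * (R + δ) ^ (k + l + 1) := by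
    rw [show k + l + 1 = k + 1 + l by ring, hVdef, ← ballIntegral_sq hpl (by positivity)]
    exact monotone_ballIntegral hp0 (by nlinarith)
  have h4 : ballSum p ((R + -δ) ^ 2 + (2 * k + 2 : ℕ) * h) ≤ ballSum p (R ^ 2) :=
    monotone_ballSum hp0 (by nlinarith)
  rw [ballIntegral_sq hpl (by linarith), ← hVdef, show k + 1 + l = k + l + 1 by ring] at h2
  have e1 := herr R hR0.le le_rfl
  have e2 := herr (R + -δ) (by linarith) (by linarith)
  have h5 := mul_le_mul_of_nonneg_left hup.2 hV
  have h6 := mul_le_mul_of_nonneg_left hlo.1 hV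
  rw [show k + 1 + l = k + l + 1 by ring, abs_le]
  constructor <;> linarith

lemma HasRieszDecay.ballSum_isBigO {k l : ℕ} (hk : 0 < k) {p : MvPolynomial (Fin (k + 1)) ℝ}
    (hp : HasRieszDecay l p) (hp0 : ∀ x, 0 ≤ MvPolynomial.eval x p)
    (hpl : ∀ (c : ℝ) x, MvPolynomial.eval (c • x) p = c ^ l * MvPolynomial.eval x p)
    {q : ℝ} (hq : 0 ≤ q) :
    (fun lam : ℝ => ballSum p (lam + q) - ballIntegral p 1 * lam ^ (((k + 1 + l : ℕ) : ℝ) / 2))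
      =O[atTop] fun lam : ℝ => lam ^ ((k + l - k / (k + 2)) / 2 : ℝ) := by
  obtain ⟨C, hC, H⟩ := hp.abs_ballSum_sub_le hk hp0 hpl
  have hV := ballIntegral_nonneg hp0 1
  set V := ballIntegral p 1 with hVdef
  set α : ℝ := (k + l - k / (k + 2)) / 2 with hα
  have hk1 : (1 : ℝ) ≤ k := by exact_mod_cast hk
  have hfrac : (k : ℝ) / (k + 2) ≤ 1 := (div_le_one (by positivity)).2 (by linarith)
  have hα0 : 0 ≤ α := by
    rw [hα]
    have : (0 : ℝ) ≤ l := by positivity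
    linarith
  have hα1 : ((k + l : ℝ) - 1) / 2 ≤ α := by
    rw [hα]
    linarith
  refine IsBigO.of_bound
    (C * (1 + q) ^ α + V * ((k + l + 1) * 2 ^ (k + l) * q)) ?_
  filter_upwards [eventually_ge_atTop (1 : ℝ), eventually_ge_atTop q,
    eventually_ge_atTop ((2 * k + 2 : ℝ) ^ (2 * (k + 2)))] with lam h1 hlq h2
  have hlam : 0 < lam := by linarith
  set μ := lam + q with hμ
  have hμ0 : 0 < μ := by positivity
  set u : ℝ := μ ^ (1 / (2 * (k + 2)) : ℝ) with hu
  have huk : 2 * k + 2 ≤ u := by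
    rw [hu]
    have : (2 * k + 2 : ℝ) = ((2 * k + 2 : ℝ) ^ (2 * (k + 2))) ^ (1 / (2 * (k + 2)) : ℝ) := by
      rw [← Real.rpow_natCast, ← Real.rpow_mul (by positivity)]
      push_cast
      rw [mul_one_div_cancel (by positivity), Real.rpow_one]
    rw [this]
    exact Real.rpow_le_rpow (by positivity) (by linarith) (by positivity)
  have huR : √μ = u ^ (k + 2) := by
    rw [hu, ← Real.rpow_mul_natCast hμ0.le, Real.sqrt_eq_rpow]
    congr 1
    push_cast
    field_simp
  have hb := H u huk _ huR
  rw [Real.sq_sqrt hμ0.le] at hb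
  have hE : √μ ^ (k + l) / u ^ k = μ ^ α := by
    rw [hu, Real.sqrt_eq_rpow, ← Real.rpow_mul_natCast hμ0.le, ← Real.rpow_mul_natCast hμ0.le,
      ← Real.rpow_sub hμ0, hα]
    congr 1
    push_cast
    field_simp
  have hEle : μ ^ α ≤ (1 + q) ^ α * lam ^ α := by
    rw [← Real.mul_rpow (by positivity) hlam.le]
    exact Real.rpow_le_rpow hμ0.le (by rw [hμ]; nlinarith) hα0
  have hs1 : 1 ≤ √lam := Real.one_le_sqrt.2 h1
  have hs0 : 0 < √lam := by linarith
  have hss : √lam ≤ √μ := Real.sqrt_le_sqrt (by linarith)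
  have hdiff : √μ - √lam ≤ q / √lam := by
    rw [le_div_iff₀ hs0]
    have e1 := Real.mul_self_sqrt hlam.le
    have e2 := Real.mul_self_sqrt hμ0.le
    nlinarith
  have hql : q / √lam ≤ √lam := by
    rw [div_le_iff₀ hs0, Real.mul_self_sqrt hlam.le]
    exact hlq
  have hd0 : |√μ - √lam| = √μ - √lam := abs_of_nonneg (by linarith)
  have hpow := abs_add_pow_sub_pow_le (k + l) (R := √lam) (δ := √μ - √lam) hs0.le
    (by rw [hd0]; linarith)
  rw [add_sub_cancel, hd0] at hpow
  have hlow : q / √lam * √lam ^ (k + l) ≤ q * lam ^ α := by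
    have e : √lam ^ (k + l) / √lam = lam ^ (((k + l : ℝ) - 1) / 2) := by
      rw [Real.sqrt_eq_rpow, ← Real.rpow_mul_natCast hlam.le, ← Real.rpow_sub hlam]
      congr 1
      push_cast
      ring
    rw [div_mul_eq_mul_div, mul_div_assoc, e]
    exact mul_le_mul_of_nonneg_left (Real.rpow_le_rpow_of_exponent_le h1 hα1) hq
  have hpow2 : |√μ ^ (k + l + 1) - √lam ^ (k + l + 1)|
      ≤ (k + l + 1) * 2 ^ (k + l) * (q * lam ^ α) := by
    refine hpow.trans ?_
    push_cast
    refine mul_le_mul_of_nonneg_left (le_trans ?_ hlow) (by positivity)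
    exact mul_le_mul_of_nonneg_right hdiff (by positivity)
  have hmain : lam ^ (((k + 1 + l : ℕ) : ℝ) / 2) = √lam ^ (k + l + 1) := by
    rw [Real.sqrt_eq_rpow, ← Real.rpow_mul_natCast hlam.le]
    congr 1
    push_cast
    ring
  rw [show k + 1 + l = k + l + 1 by ring] at hb
  rw [hmain, Real.norm_eq_abs, Real.norm_of_nonneg (by positivity)]
  calc |ballSum p μ - V * √lam ^ (k + l + 1)|
      = |(ballSum p μ - V * √μ ^ (k + l + 1))
          + V * (√μ ^ (k + l + 1) - √lam ^ (k + l + 1))| := by ring_nf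
    _ ≤ C * μ ^ α + V * ((k + l + 1) * 2 ^ (k + l) * (q * lam ^ α)) := by
      refine (abs_add_le _ _).trans (add_le_add (hE ▸ hb) ?_)
      rw [abs_mul, abs_of_nonneg hV]
      exact mul_le_mul_of_nonneg_left hpow2 hV
    _ ≤ C * ((1 + q) ^ α * lam ^ α) + V * ((k + l + 1) * 2 ^ (k + l) * (q * lam ^ α)) := by
      gcongr
    _ = _ := by ring

/-- The pairs `i < j` of indices. -/
def ltPairs (n : ℕ) : Finset (Fin n × Fin n) := Finset.univ.filter fun p => p.1 < p.2

lemma card_ltPairs (k : ℕ) : 2 * (ltPairs (k + 1)).card = (k + 1) * k := by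
  have h : (ltPairs (k + 1)).card = ∑ i ∈ Finset.range (k + 1), i := by
    rw [ltPairs, Finset.card_filter, ← Finset.univ_product_univ, Finset.sum_product_right,
      ← Fin.sum_univ_eq_sum_range (fun i => i)]
    refine Finset.sum_congr rfl fun j _ => ?_
    rw [← Finset.card_filter]
    exact (congrArg Finset.card (by ext; simp)).trans (Fin.card_Iio j)
  rw [h, mul_comm, Finset.sum_range_id_mul_two, Nat.add_sub_cancel]

/-- The polynomial `c ∏_{i < j} (X_i² - X_j²)²`. -/
def multiplicityPoly (n : ℕ) (c : ℝ) : MvPolynomial (Fin n) ℝ :=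
  MvPolynomial.C c *
    ∏ p ∈ ltPairs n, (MvPolynomial.X p.1 ^ 2 - MvPolynomial.X p.2 ^ 2) ^ 2

lemma eval_multiplicityPoly {n : ℕ} (c : ℝ) (x : Fin n → ℝ) :
    MvPolynomial.eval x (multiplicityPoly n c)
      = c * ∏ p ∈ ltPairs n, (x p.1 ^ 2 - x p.2 ^ 2) ^ 2 := by
  simp [multiplicityPoly, map_prod]

lemma eval_multiplicityPoly_nonneg {n : ℕ} {c : ℝ} (hc : 0 ≤ c) (x : Fin n → ℝ) :
    0 ≤ MvPolynomial.eval x (multiplicityPoly n c) := by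
  rw [eval_multiplicityPoly]
  exact mul_nonneg hc (prod_nonneg fun _ _ => sq_nonneg _)

lemma eval_smul_multiplicityPoly {n : ℕ} (c s : ℝ) (x : Fin n → ℝ) :
    MvPolynomial.eval (s • x) (multiplicityPoly n c)
      = s ^ (4 * (ltPairs n).card) * MvPolynomial.eval x (multiplicityPoly n c) := by
  have h : ∀ p : Fin n × Fin n, ((s • x) p.1 ^ 2 - (s • x) p.2 ^ 2) ^ 2
      = s ^ 4 * (x p.1 ^ 2 - x p.2 ^ 2) ^ 2 := fun p => by
    simp only [Pi.smul_apply, smul_eq_mul]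
    ring
  simp only [eval_multiplicityPoly, h, Finset.prod_mul_distrib, Finset.prod_const, ← pow_mul]
  ring

lemma totalDegree_multiplicityPoly_le (n : ℕ) (c : ℝ) :
    (multiplicityPoly n c).totalDegree ≤ 4 * (ltPairs n).card := by
  refine (MvPolynomial.totalDegree_mul _ _).trans ?_
  rw [MvPolynomial.totalDegree_C, zero_add]
  refine (MvPolynomial.totalDegree_finsetProd _ _).trans ?_
  rw [mul_comm, ← smul_eq_mul]
  refine Finset.sum_le_card_nsmul _ _ _ fun p _ => ?_
  refine (MvPolynomial.totalDegree_pow _ _).trans ?_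
  have h : (MvPolynomial.X p.1 ^ 2 - MvPolynomial.X p.2 ^ 2 :
      MvPolynomial (Fin n) ℝ).totalDegree ≤ 2 := by
    refine (MvPolynomial.totalDegree_sub _ _).trans ?_
    simp [MvPolynomial.totalDegree_X_pow]
  omega

lemma tsum_ite_norm_sq_le {n : ℕ} (p : MvPolynomial (Fin n) ℝ) (ρ : EuclideanSpace ℝ (Fin n))
    (z : Fin n → ℤ) (hz : ∀ j, ρ j = z j) (m : EuclideanSpace ℝ (Fin n) → ℝ)
    (hm : ∀ x, m x = MvPolynomial.eval (WithLp.ofLp x) p) (t : ℝ) :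
    ∑' b : Fin n → ℤ,
        (if ‖((EuclideanSpace.equiv (Fin n) ℝ).symm fun i => (b i : ℝ) + ρ i)‖ ^ 2 ≤ t then
          m ((EuclideanSpace.equiv (Fin n) ℝ).symm fun i => (b i : ℝ) + ρ i) else 0)
      = ballSum p t := by
  rw [ballSum, ← (Equiv.addRight z).tsum_eq fun b : Fin n → ℤ =>
    rieszWeight 0 (t - sqLen (latticePoint b)) * MvPolynomial.eval (latticePoint b) p]
  refine tsum_congr fun b => ?_
  have h : WithLp.ofLp ((EuclideanSpace.equiv (Fin n) ℝ).symm fun i => (b i : ℝ) + ρ i)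
      = latticePoint (Equiv.addRight z b) := by
    funext i
    simp [latticePoint, hz]
  rw [hm, ← sqLen_ofLp, h, rieszWeight]
  simp only [sub_nonneg]
  split_ifs <;> simp

lemma integral_closedBall_eq_ballIntegral {n : ℕ} (p : MvPolynomial (Fin n) ℝ)
    (m : EuclideanSpace ℝ (Fin n) → ℝ) (hm : ∀ x, m x = MvPolynomial.eval (WithLp.ofLp x) p) :
    ∫ x in Metric.closedBall (0 : EuclideanSpace ℝ (Fin n)) 1, m x = ballIntegral p 1 := by
  rw [ballIntegral, ← integral_euclidean,
    ← integral_indicator Metric.isClosed_closedBall.measurableSet]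
  refine integral_congr_ae (.of_forall fun x => ?_)
  have h : x ∈ Metric.closedBall (0 : EuclideanSpace ℝ (Fin n)) 1 ↔ 0 ≤ 1 - ‖x‖ ^ 2 := by
    rw [mem_closedBall_zero_iff, sub_nonneg, sq_le_one_iff₀ (norm_nonneg x)]
  simp only [Set.indicator, h, rieszWeight, sqLen_ofLp, hm]
  split_ifs <;> simp

end WeylLaw
end

/-- **Improved Weyl law for SO(2n), n ≥ 2 (Theorem 4.1, even case).**
With `d = dim SO(2n) = n(2n−1)`, `ρ = (n−1, …, 1, 0)` the half-sum of positive roots,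
the multiplicity polynomial `m(x) = ∏_{i<l}(x_i²−x_l²)²/∏_{j<l}(a_j²−a_l²)²` (`a_j = n−j`),
and the spectral counting function
`𝓝(λ) = (2^{n−1} n!)⁻¹ Σ_{b∈ℤⁿ} m(b+ρ) 1_{|b+ρ|² ≤ λ+|ρ|²}`, one has
`𝓝(λ) = C λ^{d/2} + O(λ^α)` with `C = (2^{n−1} n!)⁻¹ ∫_{|x|≤1} m` and
`α = (2n³+n²−3n)/(2(n+1))`; in particular `α < (d−1)/2`, so the
Avakumovic–Hörmander remainder exponent is not sharp. -/
theorem stmt4 (n : ℕ) (hn : 2 ≤ n) (d : ℕ) (hd : d = n * (2 * n - 1))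
    (a : Fin n → ℝ) (ha : ∀ j, a j = (n : ℝ) - 1 - (j : ℕ))
    (ρ : EuclideanSpace ℝ (Fin n)) (hρ : ∀ j : Fin n, ρ j = (n : ℝ) - 1 - (j : ℕ))
    (m : EuclideanSpace ℝ (Fin n) → ℝ)
    (hm : ∀ x, m x =
      (∏ p ∈ Finset.univ.filter (fun p : Fin n × Fin n => p.1 < p.2),
          (x p.1 ^ 2 - x p.2 ^ 2) ^ 2) /
      (∏ p ∈ Finset.univ.filter (fun p : Fin n × Fin n => p.1 < p.2),
          (a p.1 ^ 2 - a p.2 ^ 2) ^ 2))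
    (𝓝 : ℝ → ℝ)
    (h𝓝 : ∀ lam : ℝ, 𝓝 lam = (1 / ((2 : ℝ) ^ (n - 1) * n.factorial)) *
      ∑' b : Fin n → ℤ,
        if ‖((EuclideanSpace.equiv (Fin n) ℝ).symm fun i => (b i : ℝ) + ρ i)‖ ^ 2
            ≤ lam + ‖ρ‖ ^ 2 then
          m ((EuclideanSpace.equiv (Fin n) ℝ).symm fun i => (b i : ℝ) + ρ i) else 0)
    (C α : ℝ)
    (hC : C = (1 / ((2 : ℝ) ^ (n - 1) * n.factorial)) *
      ∫ x in Metric.closedBall (0 : EuclideanSpace ℝ (Fin n)) 1, m x)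
    (hα : α = (2 * (n : ℝ) ^ 3 + (n : ℝ) ^ 2 - 3 * n) / (2 * ((n : ℝ) + 1))) :
    (fun lam : ℝ => 𝓝 lam - C * lam ^ ((d : ℝ) / 2)) =O[atTop] (fun lam => lam ^ α)
      ∧ α < ((d : ℝ) - 1) / 2 := by
  obtain ⟨k, rfl⟩ : ∃ k, n = k + 1 := ⟨n - 1, by omega⟩
  have hk : 0 < k := by omega
  have hdk : d = k + 1 + 2 * ((k + 1) * k) := by
    rw [hd, show 2 * (k + 1) - 1 = 2 * k + 1 by omega]
    ring
  have hαk : α = (k + (2 * ((k + 1) * k) : ℕ) - k / (k + 2)) / 2 := by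
    rw [hα]
    push_cast
    rw [show (k : ℝ) + 1 + 1 = k + 2 by ring]
    field_simp
    ring
  constructor
  · set c : ℝ := (∏ p ∈ Finset.univ.filter (fun p : Fin (k + 1) × Fin (k + 1) => p.1 < p.2),
      (a p.1 ^ 2 - a p.2 ^ 2) ^ 2)⁻¹ with hc
    have hc0 : 0 ≤ c := inv_nonneg.2 (prod_nonneg fun _ _ => sq_nonneg _)
    have hmp : ∀ x, m x
        = MvPolynomial.eval (WithLp.ofLp x) (WeylLaw.multiplicityPoly (k + 1) c) := fun x => by
      rw [hm, WeylLaw.eval_multiplicityPoly, div_eq_mul_inv, mul_comm]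
      rfl
    have hz : ∀ j : Fin (k + 1), ρ j = ((k - j : ℤ) : ℝ) := fun j => by
      rw [hρ]
      push_cast
      ring
    have hl : 4 * (WeylLaw.ltPairs (k + 1)).card = 2 * ((k + 1) * k) := by
      rw [← WeylLaw.card_ltPairs]
      ring
    have key := (WeylLaw.hasRieszDecay_of_totalDegree_le _ _
      (hl ▸ WeylLaw.totalDegree_multiplicityPoly_le (k + 1) c)).ballSum_isBigO hk
      (WeylLaw.eval_multiplicityPoly_nonneg hc0)
      (fun s x => hl ▸ WeylLaw.eval_smul_multiplicityPoly c s x) (sq_nonneg ‖ρ‖)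
    rw [← hαk, ← hdk] at key
    refine (key.const_mul_left (1 / ((2 : ℝ) ^ (k + 1 - 1) * (k + 1).factorial))).congr_left
      fun lam => ?_
    rw [h𝓝, hC, WeylLaw.tsum_ite_norm_sq_le _ ρ _ hz m hmp,
      WeylLaw.integral_closedBall_eq_ballIntegral _ m hmp]
    ring
  · have hk1 : (1 : ℝ) ≤ k := by exact_mod_cast hk
    have hfrac : 0 < (k : ℝ) / (k + 2) := by positivity
    rw [hαk, hdk]
    push_cast
    linarith
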